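/- arXiv:math/9806031 — 8 statements merged into one kernel-verified Lean document; each statement's English description precedes it below -/
import Mathlib

section
/- Let N ≥ 1 and 1 ≤ k ≤ N. Let f be a signature of length N with f_N ≥ 0. Then in the polynomial ring ℤ[z₁,…,z_N] one has the identity det((z_j)^{f_i+N−i})_{i,j=1}^{N} · e_k(z₁,…,z_N) = Σ_g det((z_j)^{g_i+N−i})_{i,j=1}^{N}, where e_k is the k-th elementary symmetric polynomial and the sum runs over all signatures g of length N with g ≻_k f (equivalently, the Pieri rule X_f · X_k = Σ_{g ≻_k f} X_g for the quotients X_f = det(z_j^{f_i+N−i})/det(z_j^{N−i})). -/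
/-- Multiplying an alternant by `e_k` adds one to `k` of the exponents in all possible ways. -/
theorem det_X_pow_mul_esymm {n R : Type*} [Fintype n] [DecidableEq n] [CommRing R]
    (a : n → ℕ) (k : ℕ) :
    Matrix.det (Matrix.of fun i j : n => (MvPolynomial.X j : MvPolynomial n R) ^ a i) *
      MvPolynomial.esymm n R k =
    ∑ S ∈ Finset.powersetCard k Finset.univ,
      Matrix.det (Matrix.of fun i j : n =>
        (MvPolynomial.X j : MvPolynomial n R) ^ (a i + if i ∈ S then 1 else 0)) := by
  simp_rw [← Matrix.det_transpose (Matrix.of _), Matrix.det_apply', Matrix.transpose_apply,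
    Matrix.of_apply]
  rw [Finset.sum_comm, Finset.sum_mul]
  refine Finset.sum_congr rfl fun σ _ => ?_
  rw [← MvPolynomial.rename_esymm n R k σ, MvPolynomial.esymm, map_sum, Finset.mul_sum]
  refine Finset.sum_congr rfl fun S _ => ?_
  simp_rw [pow_add, Finset.prod_mul_distrib, map_prod, MvPolynomial.rename_X, mul_assoc]
  congr 2
  simp [pow_ite, Finset.prod_ite_mem]

theorem Fin.antitone_of_succ_le {α : Type*} [Preorder α] {N : ℕ} {g : Fin N → α}
    (h : ∀ p (hp : p + 1 < N), g ⟨p + 1, hp⟩ ≤ g ⟨p, by omega⟩) : Antitone g := by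
  cases N with
  | zero => exact fun i => i.elim0
  | succ n => exact Fin.antitone_iff_succ_le.2 fun i => h i (by omega)

/-- Pieri rule: `X_f · e_k = Σ_{g ≻_k f} X_g` as an identity of alternants in
`ℤ[z₁,…,z_N]`, where the sum runs over the subsets `S` of rows (of size `k`) such
that adding one box to each row in `S` again yields a signature `g = f + 1_S`. -/
theorem pieri_rule (N k : ℕ) (hN : 1 ≤ N) (hk1 : 1 ≤ k) (hkN : k ≤ N)
    (f : Fin N → ℤ) (hsig : ∀ i j : Fin N, i ≤ j → f j ≤ f i)
    (hfN : 0 ≤ f ⟨N - 1, by omega⟩) :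
    Matrix.det (Matrix.of fun i j : Fin N =>
        (MvPolynomial.X j : MvPolynomial (Fin N) ℤ) ^ ((f i).toNat + (N - 1 - (i : ℕ)))) *
      MvPolynomial.esymm (Fin N) ℤ k =
    ∑ S ∈ Finset.univ.filter (fun S : Finset (Fin N) =>
        S.card = k ∧ ∀ i j : Fin N, i ≤ j →
          f j + (if j ∈ S then 1 else 0) ≤ f i + (if i ∈ S then 1 else 0)),
      Matrix.det (Matrix.of fun i j : Fin N =>
        (MvPolynomial.X j : MvPolynomial (Fin N) ℤ) ^
          ((f i + (if i ∈ S then 1 else 0)).toNat + (N - 1 - (i : ℕ)))) := by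
  have hf : ∀ i, 0 ≤ f i := fun i => hfN.trans (hsig _ _ (Fin.le_def.2 (by simp; omega)))
  rw [det_X_pow_mul_esymm]
  symm
  have hexp : ∀ (S : Finset (Fin N)) (i : Fin N),
      (f i + (if i ∈ S then 1 else 0)).toNat + (N - 1 - (i : ℕ)) =
        (f i).toNat + (N - 1 - (i : ℕ)) + if i ∈ S then 1 else 0 := by
    intro S i
    have := hf i
    split_ifs <;> omega
  simp_rw [hexp]
  refine Finset.sum_subset (fun S hS => ?_) fun S hS hS' => ?_
  · simpa [Finset.mem_powersetCard] using (Finset.mem_filter.1 hS).2.1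
  have hanti : ¬ Antitone fun i : Fin N => f i + (if i ∈ S then 1 else 0) := fun h =>
    hS' (Finset.mem_filter.2 ⟨Finset.mem_univ _, (Finset.mem_powersetCard.1 hS).2, fun _ _ => @h _ _⟩)
  obtain ⟨p, hp, hlt⟩ : ∃ p, ∃ hp : p + 1 < N,
      f ⟨p, by omega⟩ + (if (⟨p, by omega⟩ : Fin N) ∈ S then 1 else 0) <
        f ⟨p + 1, hp⟩ + (if (⟨p + 1, hp⟩ : Fin N) ∈ S then 1 else 0) := by
    by_contra! h
    exact hanti (Fin.antitone_of_succ_le h)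
  have hle := hsig ⟨p, by omega⟩ ⟨p + 1, hp⟩ (Fin.le_def.2 (by simp))
  refine Matrix.det_zero_of_row_eq (i := ⟨p, by omega⟩) (j := ⟨p + 1, hp⟩) (by simp) ?_
  funext j
  simp only [Matrix.of_apply]
  congr 1
  split_ifs at hlt ⊢ <;> omega
end

section
/- Let M be a von Neumann algebra on a complex Hilbert space H and let Ω ∈ H be cyclic both for M and for its commutant M′. Let K be the closure of {aΩ : a ∈ M, a* = a}, a closed real-linear subspace of H. Then K + iK is dense in H and K ∩ iK = (0). -/
open scoped Pointwise

namespace VonNeumannAlgebra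

variable {H : Type*} [NormedAddCommGroup H] [InnerProductSpace ℂ H] [CompleteSpace H]

theorem smul_mem_of_mem (M : VonNeumannAlgebra H) (c : ℂ) {a : H →L[ℂ] H} (ha : a ∈ M) :
    c • a ∈ M :=
  M.toStarSubalgebra.smul_mem ha c

/-- Every element of a von Neumann algebra is `b + i c` with `b`, `c` self-adjoint elements. -/
theorem exists_isSelfAdjoint_add_I_smul (M : VonNeumannAlgebra H) {a : H →L[ℂ] H} (ha : a ∈ M) :
    ∃ b ∈ M, ∃ c ∈ M, IsSelfAdjoint b ∧ IsSelfAdjoint c ∧ a = b + Complex.I • c := by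
  refine ⟨(1 / 2 : ℂ) • (a + star a), M.smul_mem_of_mem _ (add_mem ha (star_mem ha)),
    (-Complex.I / 2) • (a - star a), M.smul_mem_of_mem _ (sub_mem ha (star_mem ha)), ?_, ?_, ?_⟩
  · simp [IsSelfAdjoint, star_smul, add_comm]
  · rw [IsSelfAdjoint, star_smul, star_sub, star_star, ← neg_sub a (star a), smul_neg, ← neg_smul]
    congr 1
    simp [neg_div]
  · rw [smul_smul, show Complex.I * (-Complex.I / 2) = 1 / 2 by
      linear_combination (-1 / 2 : ℂ) * Complex.I_mul_I]
    module

/-- The vectors `aΩ` with `a ∈ M` form a subspace. -/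
theorem exists_eq_apply_of_mem_span (M : VonNeumannAlgebra H) {Ω x : H}
    (hx : x ∈ Submodule.span ℂ {x : H | ∃ a ∈ M, x = a Ω}) : ∃ a ∈ M, x = a Ω := by
  induction hx using Submodule.span_induction with
  | mem x h => exact h
  | zero => exact ⟨0, zero_mem M, by simp⟩
  | add x y _ _ hx hy =>
    obtain ⟨a, ha, rfl⟩ := hx
    obtain ⟨b, hb, rfl⟩ := hy
    exact ⟨a + b, add_mem ha hb, by simp⟩
  | smul c x _ hx =>
    obtain ⟨a, ha, rfl⟩ := hx
    exact ⟨c • a, M.smul_mem_of_mem c ha, by simp⟩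

/-- Self-adjoint elements of `M` and `M′` give vectors with real inner product. -/
theorem im_inner_apply_apply_eq_zero (M : VonNeumannAlgebra H) (Ω : H) {a b : H →L[ℂ] H}
    (ha : a ∈ M) (hb : b ∈ M.commutant) (hsa : IsSelfAdjoint a) (hsb : IsSelfAdjoint b) :
    (inner ℂ (a Ω) (b Ω)).im = 0 := by
  rw [← Complex.conj_eq_iff_im, inner_conj_symm]
  have hab : a (b Ω) = b (a Ω) := congr($(mem_commutant_iff.mp hb a ha) Ω)
  calc inner ℂ (b Ω) (a Ω) = inner ℂ Ω (b (a Ω)) := hsb.isSymmetric Ω (a Ω)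
    _ = inner ℂ Ω (a (b Ω)) := by rw [hab]
    _ = inner ℂ (a Ω) (b Ω) := (hsa.isSymmetric Ω (b Ω)).symm

theorem im_inner_eq_zero_of_mem_closure (M : VonNeumannAlgebra H) {Ω ξ : H} {b : H →L[ℂ] H}
    (hb : b ∈ M.commutant) (hsb : IsSelfAdjoint b)
    (hξ : ξ ∈ closure {x : H | ∃ a : H →L[ℂ] H, a ∈ M ∧ IsSelfAdjoint a ∧ x = a Ω}) :
    (inner ℂ ξ (b Ω)).im = 0 := by
  have hclosed : IsClosed {x : H | (inner ℂ x (b Ω)).im = 0} :=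
    isClosed_eq (by fun_prop) continuous_const
  refine closure_minimal ?_ hclosed hξ
  rintro _ ⟨a, ha, hsa, rfl⟩
  exact M.im_inner_apply_apply_eq_zero Ω ha hb hsa hsb

end VonNeumannAlgebra

/-- If `Ω` is cyclic for a von Neumann algebra `M` and for `M′`, and
`K = closure {aΩ : a ∈ M self-adjoint}`, then `K + iK` is dense and `K ∩ iK = (0)`. -/
theorem modular_subspace_of_cyclic_separating
    {H : Type*} [NormedAddCommGroup H] [InnerProductSpace ℂ H] [CompleteSpace H]
    (M : VonNeumannAlgebra H) (Ω : H)
    (hcyc : Dense ((Submodule.span ℂ {x : H | ∃ a ∈ M, x = a Ω}) : Set H))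
    (hcyc' : Dense ((Submodule.span ℂ {x : H | ∃ a ∈ M.commutant, x = a Ω}) : Set H))
    (K : Set H)
    (hK : K = closure {x : H | ∃ a : H →L[ℂ] H, a ∈ M ∧ IsSelfAdjoint a ∧ x = a Ω}) :
    Dense (K + Complex.I • K) ∧ ∀ ξ ∈ K, ξ ∈ Complex.I • K → ξ = 0 := by
  subst hK
  constructor
  · refine hcyc.mono fun x hx => ?_
    obtain ⟨a, ha, rfl⟩ := M.exists_eq_apply_of_mem_span hx
    obtain ⟨b, hb, c, hc, hsb, hsc, rfl⟩ := M.exists_isSelfAdjoint_add_I_smul ha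
    exact Set.add_mem_add (subset_closure ⟨b, hb, hsb, rfl⟩)
      (Set.smul_mem_smul_set (subset_closure ⟨c, hc, hsc, rfl⟩))
  · rintro ξ hξ ⟨η, hη, hηξ⟩
    have hηξ' : Complex.I • η = ξ := hηξ
    have horth : ∀ b ∈ M.commutant, IsSelfAdjoint b → inner ℂ ξ (b Ω) = 0 := by
      intro b hb hsb
      refine Complex.ext ?_ (M.im_inner_eq_zero_of_mem_closure hb hsb hξ)
      simp [← hηξ', M.im_inner_eq_zero_of_mem_closure hb hsb hη]
    refine hcyc'.eq_zero_of_inner_left ℂ fun x hx => ?_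
    obtain ⟨a, ha, rfl⟩ := M.commutant.exists_eq_apply_of_mem_span hx
    obtain ⟨b, hb, c, hc, hsb, hsc, rfl⟩ := M.commutant.exists_isSelfAdjoint_add_I_smul ha
    simp [inner_add_right, inner_smul_right, horth b hb hsb, horth c hc hsc]
end

section
/- Let m, d ≥ 1, R > 0, and let F : ℂ^m × ℂ → M_d(ℂ) be analytic on ℂ^m × B(0,R), where B(0,R) ⊆ ℂ is the open disc of radius R. Put A₀(t) = F(t,0) and let U = {t ∈ ℂ^m : for all eigenvalues λ, μ of A₀(t), λ − μ is not a positive integer}. Then U is open in ℂ^m and there exists a map g, analytic on U × B(0,R) with values in M_d(ℂ), such that for every t ∈ U: g(t,0) = 1; g(t,z) is an invertible matrix for every z ∈ B(0,R); and z·(∂g/∂z)(t,z) = F(t,z)·g(t,z) − g(t,z)·A₀(t) for all z ∈ B(0,R). Moreover, for each fixed t ∈ U, g(t,·) is the unique analytic function on B(0,R) taking the value 1 at z = 0 and satisfying this differential equation. (Equivalently, the gauge transformation g reduces the ODE f′ = A(t,z)f, A(t,z) = F(t,z)/z, to f′ = (A₀(t)/z)f.) -/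
/-- The set of parameters `t` where no two eigenvalues of `A₀(t) = F(t,0)` differ by a
positive integer. -/
def goodParams (m d : ℕ) (F : ((Fin m → ℂ) × ℂ) → ((Fin d → ℂ) →L[ℂ] (Fin d → ℂ))) :
    Set (Fin m → ℂ) :=
  {t | ∀ lam ∈ spectrum ℂ (F (t, 0)), ∀ mu ∈ spectrum ℂ (F (t, 0)),
    ∀ n : ℕ, 0 < n → lam - mu ≠ (n : ℂ)}

section Osgood

open Metric Topology Set

universe u

/-- A continuous family of continuous maps that is pointwise holomorphic is holomorphic. -/
theorem ContinuousMap.differentiableOn_of_forall_apply {K : Type*} [TopologicalSpace K]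
    [CompactSpace K] {E : Type*} [NormedAddCommGroup E] [NormedSpace ℂ E] [CompleteSpace E]
    {φ : ℂ → C(K, E)} {W : Set ℂ} (hW : IsOpen W) (hc : ContinuousOn φ W)
    (hd : ∀ k, DifferentiableOn ℂ (fun s => φ s k) W) : DifferentiableOn ℂ φ W := by
  intro c hcW
  obtain ⟨r, hr, hrW⟩ := nhds_basis_closedBall.mem_iff.1 (hW.mem_nhds hcW)
  lift r to NNReal using hr.le
  have hci : CircleIntegrable φ c r :=
    (hc.mono (sphere_subset_closedBall.trans hrW)).circleIntegrable r.2
  have hps := hasFPowerSeriesOn_cauchy_integral hci (by exact_mod_cast hr)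
  have heq : ∀ s ∈ ball c (r : ℝ),
      φ s = (2 * Real.pi * Complex.I : ℂ)⁻¹ • ∮ z in C(c, r), (z - s)⁻¹ • φ z := by
    intro s hs
    ext k
    have h1 : DiffContOnCl ℂ (fun z => φ z k) (ball c r) :=
      ((hd k).mono (closure_ball_subset_closedBall.trans hrW)).diffContOnCl
    rw [← h1.two_pi_i_inv_smul_circleIntegral_sub_inv_smul hs, ContinuousMap.smul_apply]
    congr 1
    have hint : CircleIntegrable (fun z => (z - s)⁻¹ • φ z) c r := by
      refine ContinuousOn.circleIntegrable r.2 (ContinuousOn.fun_smul ?_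
        (hc.mono (sphere_subset_closedBall.trans hrW)))
      refine ContinuousOn.inv₀ (by fun_prop) fun z hz => sub_ne_zero.2 ?_
      rintro rfl
      exact (mem_ball.1 hs).ne (mem_sphere.1 hz)
    have h2 := (ContinuousMap.evalCLM ℂ (M := E) k).intervalIntegral_comp_comm hint.out
    simpa [circleIntegral] using h2
  have : AnalyticAt ℂ φ c := by
    refine hps.analyticAt.congr ?_
    filter_upwards [ball_mem_nhds c hr] with s hs using (heq s hs).symm
  exact this.differentiableAt.differentiableWithinAt

theorem differentiableOn_comp_line {V E : Type*} [AddCommGroup V] [Module ℂ V]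
    [NormedAddCommGroup E] [NormedSpace ℂ E] {f : V → E} {W : Set V}
    (hd : ∀ x ∈ W, ∀ v, DifferentiableAt ℂ (fun s : ℂ => f (x + s • v)) 0) (x v : V) :
    DifferentiableOn ℂ (fun s : ℂ => f (x + s • v)) {s | x + s • v ∈ W} := by
  intro s hs
  have h1 := hd _ hs v
  have h2 : DifferentiableAt ℂ (fun s' : ℂ => f (x + s • v + (s' - s) • v)) s :=
    DifferentiableAt.comp s (g := fun s : ℂ => f (x + _ + s • v)) (f := fun s' => s' - s)
      (by simpa using h1) (by fun_prop)
  refine (h2.congr_of_eventuallyEq (.of_forall fun s' => ?_)).differentiableWithinAt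
  congr 1
  module

/-- Integration over a circle of the product of a scalar and a vector valued function, as a
continuous bilinear map. -/
noncomputable def circleIntegralBilin (E : Type*) [NormedAddCommGroup E] [NormedSpace ℂ E]
    [CompleteSpace E] (a : ℂ) (r : ℝ) (hr : 0 ≤ r) :
    C(sphere a r, ℂ) →L[ℂ] C(sphere a r, E) →L[ℂ] E :=
  LinearMap.mkContinuous₂
    (LinearMap.mk₂ ℂ (fun k φ => ∫ θ in (0 : ℝ)..(2 * Real.pi),
        k ⟨circleMap a r θ, circleMap_mem_sphere a hr θ⟩ •
          φ ⟨circleMap a r θ, circleMap_mem_sphere a hr θ⟩)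
      (fun k k' φ => by
        simp only [ContinuousMap.add_apply, add_smul]
        exact intervalIntegral.integral_add (Continuous.intervalIntegrable (by fun_prop) _ _)
          (Continuous.intervalIntegrable (by fun_prop) _ _))
      (fun c k φ => by
        simp only [ContinuousMap.smul_apply, smul_assoc]
        exact intervalIntegral.integral_smul _ _)
      (fun k φ φ' => by
        simp only [ContinuousMap.add_apply, smul_add]
        exact intervalIntegral.integral_add (Continuous.intervalIntegrable (by fun_prop) _ _)
          (Continuous.intervalIntegrable (by fun_prop) _ _))
      (fun c k φ => by
        simp only [ContinuousMap.smul_apply, smul_comm _ c]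
        exact intervalIntegral.integral_smul _ _))
    |2 * Real.pi - 0| (fun k φ => by
      simp only [LinearMap.mk₂_apply]
      have := intervalIntegral.norm_integral_le_of_norm_le_const (a := 0) (b := 2 * Real.pi)
        (C := ‖k‖ * ‖φ‖) (f := fun θ => k ⟨circleMap a r θ, circleMap_mem_sphere a hr θ⟩ •
          φ ⟨circleMap a r θ, circleMap_mem_sphere a hr θ⟩) (fun θ _ => by
            rw [norm_smul]
            gcongr
            · exact k.norm_coe_le_norm _
            · exact φ.norm_coe_le_norm _)
      linarith)

theorem circleIntegralBilin_apply {E : Type*} [NormedAddCommGroup E] [NormedSpace ℂ E]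
    [CompleteSpace E] (a : ℂ) (r : ℝ) (hr : 0 ≤ r) (k : C(sphere a r, ℂ))
    (φ : C(sphere a r, E)) :
    circleIntegralBilin E a r hr k φ = ∫ θ in (0 : ℝ)..(2 * Real.pi),
        k ⟨circleMap a r θ, circleMap_mem_sphere a hr θ⟩ •
          φ ⟨circleMap a r θ, circleMap_mem_sphere a hr θ⟩ := rfl

/-- **Osgood's lemma** on `ℂ^n`. -/
theorem analyticOnNhd_fin_of_continuousOn_of_differentiableAt_line (n : ℕ) :
    ∀ {E : Type u} [NormedAddCommGroup E] [NormedSpace ℂ E] [CompleteSpace E]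
    {f : (Fin n → ℂ) → E} {W : Set (Fin n → ℂ)}, IsOpen W → ContinuousOn f W →
    (∀ x ∈ W, ∀ v, DifferentiableAt ℂ (fun s : ℂ => f (x + s • v)) 0) →
    AnalyticOnNhd ℂ f W := by
  induction n with
  | zero =>
    intro E _ _ _ f W _ _ _ x _
    refine (analyticAt_const (v := f x)).congr (.of_forall fun y => ?_)
    rw [Subsingleton.elim x y]
  | succ n ih =>
    intro E _ _ _ f W hW hc hd
    let e : (ℂ × (Fin n → ℂ)) ≃L[ℂ] (Fin (n + 1) → ℂ) := Fin.consEquivL ℂ (fun _ => ℂ)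
    suffices H : ∀ p : ℂ × (Fin n → ℂ), e p ∈ W → AnalyticAt ℂ (f ∘ e) p by
      intro x hx
      have h1 := H (e.symm x) (by simpa using hx)
      have h2 : AnalyticAt ℂ ((f ∘ e) ∘ e.symm) x :=
        h1.comp (e.symm.toContinuousLinearMap.analyticAt x)
      simpa [Function.comp_assoc] using h2
    rintro ⟨a, b⟩ hab
    obtain ⟨r, hr, hrW⟩ := nhds_basis_closedBall.mem_iff.1
      (e.continuous.continuousAt.preimage_mem_nhds (hW.mem_nhds hab))
    rw [← closedBall_prod_same] at hrW
    have hfe : ContinuousOn (f ∘ e) (closedBall a r ×ˢ closedBall b r) :=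
      hc.comp e.continuous.continuousOn hrW
    set K := sphere a r
    set Φ : (Fin n → ℂ) → C(K, E) := fun v => .mkD (fun w : K => f (e (w, v))) 0
    have hΦu : ContinuousOn (Function.uncurry fun (v : Fin n → ℂ) (w : K) => f (e (w, v)))
        (ball b r ×ˢ univ) := by
      refine hfe.comp (f := fun q : (Fin n → ℂ) × K => ((q.2 : ℂ), q.1)) (by fun_prop) ?_
      rintro ⟨v, w⟩ ⟨hv, -⟩
      exact ⟨sphere_subset_closedBall w.2, ball_subset_closedBall hv⟩
    have hΦc : ∀ v ∈ ball b r, Continuous fun w : K => f (e (w, v)) := fun v hv =>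
      hΦu.comp_continuous (f := fun w : K => (v, w)) (by fun_prop) fun w => ⟨hv, mem_univ _⟩
    have hΦa : ∀ v ∈ ball b r, ∀ w : K, Φ v w = f (e (w, v)) := fun v hv w =>
      ContinuousMap.mkD_apply_of_continuous (hΦc v hv)
    have hΦ : AnalyticOnNhd ℂ Φ (ball b r) := by
      have hcont : ContinuousOn Φ (ball b r) := by
        refine ContinuousMap.continuousOn_of_continuousOn_uncurry _ (hΦu.congr ?_)
        rintro ⟨v, w⟩ ⟨hv, -⟩
        exact hΦa v hv w
      refine ih isOpen_ball hcont fun x hx v => ?_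
      have hopen : IsOpen {s : ℂ | x + s • v ∈ ball b r} :=
        isOpen_ball.preimage (by fun_prop)
      refine (ContinuousMap.differentiableOn_of_forall_apply hopen
        (hcont.comp (by fun_prop) fun s hs => hs) fun w => ?_).differentiableAt
        (hopen.mem_nhds (by simpa using hx))
      refine ((differentiableOn_comp_line hd (e (w, x)) (e (0, v))).mono
        (s := {s : ℂ | x + s • v ∈ ball b r}) fun s hs => ?_).congr fun s hs => ?_
      · have : e (w, x) + s • e (0, v) = e (w, x + s • v) := by
          rw [← map_smul, ← map_add]; simp
        rw [mem_ofPred_eq, this]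
        exact hrW ⟨sphere_subset_closedBall w.2, ball_subset_closedBall hs⟩
      · have : e (w, x) + s • e (0, v) = e (w, x + s • v) := by
          rw [← map_smul, ← map_add]; simp
        rw [this]
        exact hΦa _ hs w
    set κ : ℂ → C(K, ℂ) := fun z => .mkD
      (fun w : K => (2 * Real.pi * Complex.I : ℂ)⁻¹ * ((w - a) * Complex.I * (w - z)⁻¹)) 0
    have hne : ∀ z ∈ ball a r, ∀ w : K, (w : ℂ) - z ≠ 0 := by
      intro z hz w h
      rw [sub_eq_zero] at h
      exact (mem_ball.1 hz).ne (h ▸ mem_sphere.1 w.2)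
    have hκu : ContinuousOn (Function.uncurry fun (z : ℂ) (w : K) =>
        (2 * Real.pi * Complex.I : ℂ)⁻¹ * (((w : ℂ) - a) * Complex.I * (w - z)⁻¹))
        (ball a r ×ˢ univ) := by
      refine ContinuousOn.mul continuousOn_const (ContinuousOn.mul (by fun_prop) ?_)
      refine ContinuousOn.inv₀ (by fun_prop) ?_
      rintro ⟨z, w⟩ ⟨hz, -⟩
      exact hne z hz w
    have hκa : ∀ z ∈ ball a r, ∀ w : K, κ z w =
        (2 * Real.pi * Complex.I : ℂ)⁻¹ * ((w - a) * Complex.I * (w - z)⁻¹) := fun z hz w =>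
      ContinuousMap.mkD_apply_of_continuous <|
        hκu.comp_continuous (f := fun w : K => (z, w)) (by fun_prop) fun w => ⟨hz, mem_univ _⟩
    have hκ : AnalyticAt ℂ κ a := by
      refine (ContinuousMap.differentiableOn_of_forall_apply isOpen_ball ?_ fun w => ?_).analyticAt
        (ball_mem_nhds a hr)
      · refine ContinuousMap.continuousOn_of_continuousOn_uncurry _ (hκu.congr ?_)
        rintro ⟨z, w⟩ ⟨hz, -⟩
        exact hκa z hz w
      · refine DifferentiableOn.congr ?_ fun z hz => hκa z hz w
        refine DifferentiableOn.const_mul (DifferentiableOn.const_mul ?_ _) _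
        exact DifferentiableOn.inv (by fun_prop) fun z hz => hne z hz w
    have hB := ((circleIntegralBilin E a r hr.le).analyticAt_bilinear (κ a, Φ b)).comp₂
      (hκ.comp (f := Prod.fst) (x := (a, b)) analyticAt_fst)
      ((hΦ b (mem_ball_self hr)).comp (f := Prod.snd) (x := (a, b)) analyticAt_snd)
    refine hB.congr ?_
    filter_upwards [prod_mem_nhds (ball_mem_nhds a hr) (ball_mem_nhds b hr)]
    rintro ⟨z, v⟩ ⟨hz, hv⟩
    have hdiff : DiffContOnCl ℂ (fun w => f (e (w, v))) (ball a r) := by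
      refine (((differentiableOn_comp_line hd (e (0, v)) (e (1, 0))).mono
        (s := closedBall a r) fun s hs => ?_).congr fun s hs => ?_).mono
        closure_ball_subset_closedBall |>.diffContOnCl
      · have : e (0, v) + s • e (1, 0) = e (s, v) := by
          rw [← map_smul, ← map_add]; simp
        rw [mem_ofPred_eq, this]
        exact hrW ⟨hs, ball_subset_closedBall hv⟩
      · have : e (0, v) + s • e (1, 0) = e (s, v) := by
          rw [← map_smul, ← map_add]; simp
        rw [this]
    have hCauchy := hdiff.two_pi_i_inv_smul_circleIntegral_sub_inv_smul hz
    simp only [Function.comp_apply]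
    rw [← hCauchy, circleIntegralBilin_apply, circleIntegral, ← intervalIntegral.integral_smul]
    refine intervalIntegral.integral_congr fun θ _ => ?_
    simp only [hκa z hz, hΦa v hv, deriv_circleMap, smul_smul, circleMap_sub_center]

/-- **Osgood's lemma**: a continuous function on an open subset of a finite-dimensional complex
space which is holomorphic along all lines is analytic. -/
theorem analyticOnNhd_of_continuousOn_of_differentiableAt_line {V : Type*}
    [NormedAddCommGroup V] [NormedSpace ℂ V] [FiniteDimensional ℂ V] {E : Type*}
    [NormedAddCommGroup E] [NormedSpace ℂ E] [CompleteSpace E] {f : V → E} {W : Set V}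
    (hW : IsOpen W) (hc : ContinuousOn f W)
    (hd : ∀ x ∈ W, ∀ v, DifferentiableAt ℂ (fun s : ℂ => f (x + s • v)) 0) :
    AnalyticOnNhd ℂ f W := by
  let e : V ≃L[ℂ] (Fin (Module.finrank ℂ V) → ℂ) := .ofFinrankEq (by simp)
  have h := analyticOnNhd_fin_of_continuousOn_of_differentiableAt_line _ (f := f ∘ e.symm)
    (hW.preimage e.symm.continuous) (hc.comp e.symm.continuous.continuousOn fun _ hx => hx)
    (fun x hx v => by simpa using hd _ hx (e.symm v))
  intro x hx
  have h2 := (h (e x) (by simpa using hx)).comp (e.toContinuousLinearMap.analyticAt x)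
  simpa [Function.comp_assoc] using h2

/-- A normally convergent series of analytic functions on an open subset of a finite-dimensional
complex space is analytic. -/
theorem analyticOnNhd_tsum_of_summable_norm {V : Type*}
    [NormedAddCommGroup V] [NormedSpace ℂ V] [FiniteDimensional ℂ V] {E : Type*}
    [NormedAddCommGroup E] [NormedSpace ℂ E] [CompleteSpace E] {ι : Type*} {f : ι → V → E}
    {W : Set V} {b : ι → ℝ} (hW : IsOpen W) (hf : ∀ i, AnalyticOnNhd ℂ (f i) W)
    (hb : Summable b) (hfb : ∀ i, ∀ x ∈ W, ‖f i x‖ ≤ b i) :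
    AnalyticOnNhd ℂ (fun x => ∑' i, f i x) W := by
  refine analyticOnNhd_of_continuousOn_of_differentiableAt_line hW
    (continuousOn_tsum (fun i => (hf i).continuousOn) hb hfb) fun x hx v => ?_
  have hopen : IsOpen {s : ℂ | x + s • v ∈ W} := hW.preimage (by fun_prop)
  refine (Complex.differentiableOn_tsum_of_summable_norm hb (fun i => ?_) hopen
    fun i s hs => hfb i _ hs).differentiableAt (hopen.mem_nhds (by simpa using hx))
  exact (hf i).differentiableOn.comp (by fun_prop) fun s hs => hs

end Osgood

section Gauge

open Metric Topology Set Filter Finset.Nat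
open Finset.HasAntidiagonal (antidiagonal)

variable {𝔸 : Type*} [NormedRing 𝔸] [NormedAlgebra ℂ 𝔸]

/-- The operator `x ↦ n x - (a x - x a)`. -/
noncomputable def adShift (n : ℕ) (a : 𝔸) : 𝔸 →L[ℂ] 𝔸 :=
  (n : ℂ) • 1 - (ContinuousLinearMap.mul ℂ 𝔸 a - (ContinuousLinearMap.mul ℂ 𝔸).flip a)

theorem adShift_apply (n : ℕ) (a x : 𝔸) : adShift n a x = (n : ℂ) • x - (a * x - x * a) := by
  simp [adShift]

theorem analyticAt_adShift (n : ℕ) (a : 𝔸) : AnalyticAt ℂ (adShift (𝔸 := 𝔸) n) a :=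
  analyticAt_const.sub (((ContinuousLinearMap.mul ℂ 𝔸).analyticAt a).sub
    ((ContinuousLinearMap.mul ℂ 𝔸).flip.analyticAt a))

theorem norm_le_of_adShift {n : ℕ} {a : 𝔸} {L : ℝ} (ha : ‖a‖ ≤ L) (hn : 4 * L ≤ n) (hn0 : 1 ≤ n)
    (x : 𝔸) : ‖x‖ ≤ 2 / n * ‖adShift n a x‖ := by
  have hn' : (0 : ℝ) < n := by exact_mod_cast hn0
  have h1 : (n : ℂ) • x = adShift n a x + (a * x - x * a) := by rw [adShift_apply]; abel
  have h2 : n * ‖x‖ ≤ ‖adShift n a x‖ + 2 * L * ‖x‖ := by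
    calc n * ‖x‖ = ‖(n : ℂ) • x‖ := by simp [norm_smul]
      _ ≤ ‖adShift n a x‖ + (‖a * x‖ + ‖x * a‖) := by
        rw [h1]; exact (norm_add_le _ _).trans (by gcongr; exact norm_sub_le _ _)
      _ ≤ ‖adShift n a x‖ + (L * ‖x‖ + ‖x‖ * L) := by
        gcongr
        · exact (norm_mul_le _ _).trans (by gcongr)
        · exact (norm_mul_le _ _).trans (by gcongr)
      _ = _ := by ring
  rw [div_mul_eq_mul_div, le_div_iff₀ hn']
  nlinarith [norm_nonneg x]

theorem isUnit_adShift_of_le [CompleteSpace 𝔸] {n : ℕ} {a : 𝔸} (hn : 4 * ‖a‖ ≤ n) (hn0 : 1 ≤ n) :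
    IsUnit (adShift n a) := by
  have hn' : (0 : ℝ) < n := by exact_mod_cast hn0
  have hnc : (n : ℂ) ≠ 0 := by exact_mod_cast hn'.ne'
  set D := ContinuousLinearMap.mul ℂ 𝔸 a - (ContinuousLinearMap.mul ℂ 𝔸).flip a
  have hD : ‖(n : ℂ)⁻¹ • D‖ < 1 := by
    have : ‖(n : ℂ)⁻¹ • D‖ ≤ 1 / 2 := by
      refine ContinuousLinearMap.opNorm_le_bound _ (by norm_num) fun x => ?_
      have h1 : ‖D x‖ ≤ 2 * ‖a‖ * ‖x‖ := by
        refine (norm_sub_le _ _).trans ?_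
        have h2 := norm_mul_le a x
        have h3 := norm_mul_le x a
        change ‖a * x‖ + ‖x * a‖ ≤ _
        linarith
      rw [smul_apply, norm_smul, norm_inv, Complex.norm_natCast,
        inv_mul_le_iff₀ hn']
      nlinarith [norm_nonneg x]
    linarith
  have h := isUnit_one_sub_of_norm_lt_one hD
  have h2 : adShift n a = (Units.mk0 (n : ℂ) hnc) • (1 - (n : ℂ)⁻¹ • D) := by
    rw [Units.smul_def, Units.val_mk0, smul_sub, smul_inv_smul₀ hnc]
    rfl
  rw [h2]
  exact h.smul _

theorem Ring.inverse_adShift_apply {n : ℕ} {a : 𝔸} (h : IsUnit (adShift n a)) (x : 𝔸) :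
    adShift n a (Ring.inverse (adShift n a) x) = x := by
  rw [← mul_apply_eq_comp, Ring.mul_inverse_cancel _ h]; rfl

theorem Ring.inverse_adShift_apply_adShift {n : ℕ} {a : 𝔸} (h : IsUnit (adShift n a)) (x : 𝔸) :
    Ring.inverse (adShift n a) (adShift n a x) = x := by
  rw [← mul_apply_eq_comp, Ring.inverse_mul_cancel _ h]; rfl

theorem exists_eventually_isUnit_adShift [CompleteSpace 𝔸] {a₀ : 𝔸}
    (h : ∀ n, 1 ≤ n → IsUnit (adShift n a₀)) :
    ∃ C : ℝ, 0 ≤ C ∧ ∀ᶠ a in 𝓝 a₀, ∀ n, 1 ≤ n →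
      IsUnit (adShift n a) ∧ ‖Ring.inverse (adShift n a)‖ ≤ C / n := by
  obtain ⟨N, hN⟩ := exists_nat_ge (4 * (‖a₀‖ + 1))
  set C : ℝ := 2 + ∑ k ∈ Finset.range N, k * (‖Ring.inverse (adShift k a₀)‖ + 1)
  have hC0 : ∀ k ∈ Finset.range N, (0 : ℝ) ≤ k * (‖Ring.inverse (adShift k a₀)‖ + 1) :=
    fun k _ => by positivity
  refine ⟨C, by have := Finset.sum_nonneg hC0; positivity, ?_⟩
  have hsmall : ∀ᶠ a in 𝓝 a₀, ∀ n ∈ Finset.range N, 1 ≤ n →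
      IsUnit (adShift n a) ∧ ‖Ring.inverse (adShift n a)‖ < ‖Ring.inverse (adShift n a₀)‖ + 1 := by
    rw [Filter.eventually_all_finset]
    intro n _
    by_cases hn : 1 ≤ n
    swap
    · exact .of_forall fun a hn' => absurd hn' hn
    have hc : ContinuousAt (adShift (𝔸 := 𝔸) n) a₀ := (analyticAt_adShift n a₀).continuousAt
    have hi : ContinuousAt (fun a => Ring.inverse (adShift n a)) a₀ := by
      obtain ⟨u, hu⟩ := h n hn
      have := NormedRing.inverse_continuousAt u
      rw [hu] at this
      exact this.comp hc
    filter_upwards [hc.preimage_mem_nhds (Units.isOpen.mem_nhds (h n hn)),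
      hi.norm.eventually_lt_const (lt_add_one _)] with a h1 h2 _ using ⟨h1, h2⟩
  filter_upwards [hsmall, continuous_norm.continuousAt.eventually_lt_const (lt_add_one ‖a₀‖)]
    with a ha1 ha2 n hn
  have hn' : (0 : ℝ) < n := by exact_mod_cast hn
  by_cases hnN : n < N
  · obtain ⟨h1, h2⟩ := ha1 n (Finset.mem_range.2 hnN) hn
    refine ⟨h1, ?_⟩
    rw [le_div_iff₀ hn']
    have := Finset.single_le_sum hC0 (Finset.mem_range.2 hnN)
    have h3 : ‖Ring.inverse (adShift n a)‖ * n ≤ n * (‖Ring.inverse (adShift n a₀)‖ + 1) := by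
      nlinarith
    simp only [C]
    linarith
  · have hnN' : (N : ℝ) ≤ n := by exact_mod_cast not_lt.1 hnN
    have hu : IsUnit (adShift n a) := isUnit_adShift_of_le (by linarith) hn
    refine ⟨hu, ContinuousLinearMap.opNorm_le_bound _
      (by have := Finset.sum_nonneg hC0; positivity) fun x => ?_⟩
    have h1 := norm_le_of_adShift (a := a) (L := ‖a‖) (n := n) le_rfl (by linarith) hn
      (Ring.inverse (adShift n a) x)
    rw [Ring.inverse_adShift_apply hu] at h1
    refine h1.trans ?_
    gcongr
    have := Finset.sum_nonneg hC0
    simp only [C]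
    linarith

/-- The coefficients of the formal power series solution `g` of `z g' = p g - g q`, `g(0) = 1`. -/
noncomputable def gaugeCoeff (p q : ℕ → 𝔸) : ℕ → 𝔸
  | 0 => 1
  | n + 1 => Ring.inverse (adShift (n + 1) (p 0))
      (∑ k : Fin (n + 1), (p (n + 1 - k) * gaugeCoeff p q k - gaugeCoeff p q k * q (n + 1 - k)))

theorem gaugeCoeff_zero (p q : ℕ → 𝔸) : gaugeCoeff p q 0 = 1 := by rw [gaugeCoeff]

theorem gaugeCoeff_succ (p q : ℕ → 𝔸) (n : ℕ) : gaugeCoeff p q (n + 1) =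
    Ring.inverse (adShift (n + 1) (p 0)) (∑ k ∈ Finset.range (n + 1),
      (p (n + 1 - k) * gaugeCoeff p q k - gaugeCoeff p q k * q (n + 1 - k))) := by
  rw [gaugeCoeff, ← Fin.sum_univ_eq_sum_range
    fun k => p (n + 1 - k) * gaugeCoeff p q k - gaugeCoeff p q k * q (n + 1 - k)]

theorem smul_gaugeCoeff {p q : ℕ → 𝔸} (hpq : p 0 = q 0)
    (hu : ∀ n, 1 ≤ n → IsUnit (adShift n (p 0))) (n : ℕ) :
    (n : ℂ) • gaugeCoeff p q n = ∑ kl ∈ antidiagonal n, p kl.1 * gaugeCoeff p q kl.2 -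
      ∑ kl ∈ antidiagonal n, gaugeCoeff p q kl.1 * q kl.2 := by
  cases n with
  | zero => simp [gaugeCoeff_zero, hpq]
  | succ n =>
    have h := Ring.inverse_adShift_apply (hu (n + 1) (by lia)) (∑ k ∈ Finset.range (n + 1),
      (p (n + 1 - k) * gaugeCoeff p q k - gaugeCoeff p q k * q (n + 1 - k)))
    rw [← gaugeCoeff_succ, adShift_apply, Finset.sum_sub_distrib, sub_eq_iff_eq_add] at h
    rw [h, sum_antidiagonal_eq_sum_range_succ fun i j => gaugeCoeff p q i * q j,
      ← sum_antidiagonal_swap]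
    simp only [Prod.fst_swap, Prod.snd_swap]
    rw [sum_antidiagonal_eq_sum_range_succ fun i j => p j * gaugeCoeff p q i]
    rw [Finset.sum_range_succ _ (n + 1), Finset.sum_range_succ _ (n + 1)]
    simp only [Nat.sub_self, hpq]
    abel

/-- Majorant of the coefficients of a formal solution. -/
noncomputable def gaugeMajorant (D : ℝ) (n : ℕ) : ℝ :=
  ∏ j ∈ Finset.range n, (1 + D / ((j : ℝ) + 1))

theorem gaugeMajorant_pos {D : ℝ} (hD : 0 ≤ D) (n : ℕ) : 0 < gaugeMajorant D n :=
  Finset.prod_pos fun j _ => by positivity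

theorem summable_gaugeMajorant {D x : ℝ} (hD : 0 ≤ D) (hx0 : 0 < x) (hx : x < 1) :
    Summable fun n => gaugeMajorant D n * x ^ n := by
  refine summable_of_ratio_test_tendsto_lt_one hx
    (.of_forall fun n => (mul_pos (gaugeMajorant_pos hD n) (pow_pos hx0 n)).ne') ?_
  have h1 : Tendsto (fun n : ℕ => (1 + D * (1 / ((n : ℝ) + 1))) * x) atTop (𝓝 ((1 + D * 0) * x)) :=
    ((tendsto_one_div_add_atTop_nhds_zero_nat.const_mul D).const_add 1).mul_const x
  simp only [mul_zero, add_zero, one_mul] at h1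
  refine h1.congr fun n => ?_
  have := gaugeMajorant_pos hD n
  have hpos : 0 < gaugeMajorant D (n + 1) := gaugeMajorant_pos hD _
  rw [Real.norm_of_nonneg (by positivity), Real.norm_of_nonneg (by positivity), eq_div_iff
    (by positivity), gaugeMajorant, gaugeMajorant, Finset.prod_range_succ]
  ring

theorem norm_gaugeCoeff_le {p q : ℕ → 𝔸} {M C ρ : ℝ} (hC : 0 ≤ C) (hM : 0 ≤ M) (hρ : 0 < ρ)
    (hp : ∀ n, ‖p n‖ ≤ M / ρ ^ n) (hq : ∀ n, ‖q n‖ ≤ M / ρ ^ n)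
    (hi : ∀ n, 1 ≤ n → ‖Ring.inverse (adShift n (p 0))‖ ≤ C / n) (n : ℕ) :
    ρ ^ n * ‖gaugeCoeff p q n‖ ≤ ‖(1 : 𝔸)‖ * gaugeMajorant (C * (2 * M)) n := by
  suffices H : ∑ k ∈ Finset.range (n + 1), ρ ^ k * ‖gaugeCoeff p q k‖ ≤
      ‖(1 : 𝔸)‖ * gaugeMajorant (C * (2 * M)) n from
    (Finset.single_le_sum (f := fun k => ρ ^ k * ‖gaugeCoeff p q k‖)
      (fun k _ => by positivity) (Finset.self_mem_range_succ n)).trans H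
  induction n with
  | zero => simp [gaugeCoeff_zero, gaugeMajorant]
  | succ n ih =>
    rw [Finset.sum_range_succ, gaugeMajorant, Finset.prod_range_succ, ← gaugeMajorant]
    set S := ∑ k ∈ Finset.range (n + 1), ρ ^ k * ‖gaugeCoeff p q k‖
    have h1 : ρ ^ (n + 1) * ‖gaugeCoeff p q (n + 1)‖ ≤ C * (2 * M) / ((n : ℝ) + 1) * S := by
      have h2 : ρ ^ (n + 1) * ‖∑ k ∈ Finset.range (n + 1),
          (p (n + 1 - k) * gaugeCoeff p q k - gaugeCoeff p q k * q (n + 1 - k))‖ ≤ 2 * M * S := by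
        rw [Finset.mul_sum]
        refine (mul_le_mul_of_nonneg_left (norm_sum_le _ _) (by positivity)).trans ?_
        rw [Finset.mul_sum]
        refine Finset.sum_le_sum fun k hk => ?_
        have hk' : k ≤ n + 1 := (Finset.mem_range.1 hk).le
        have h3 : ‖p (n + 1 - k) * gaugeCoeff p q k - gaugeCoeff p q k * q (n + 1 - k)‖ ≤
            2 * (M / ρ ^ (n + 1 - k)) * ‖gaugeCoeff p q k‖ := by
          refine (norm_sub_le _ _).trans ?_
          have h4 := (norm_mul_le (p (n + 1 - k)) (gaugeCoeff p q k)).trans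
            (mul_le_mul_of_nonneg_right (hp _) (norm_nonneg _))
          have h5 := (norm_mul_le (gaugeCoeff p q k) (q (n + 1 - k))).trans
            (mul_le_mul_of_nonneg_left (hq _) (norm_nonneg _))
          linarith
        refine (mul_le_mul_of_nonneg_left h3 (by positivity)).trans_eq ?_
        rw [show ρ ^ (n + 1) = ρ ^ (n + 1 - k) * ρ ^ k by rw [← pow_add, Nat.sub_add_cancel hk']]
        field_simp
      rw [gaugeCoeff_succ]
      have h6 := hi (n + 1) (by lia)
      push_cast at h6
      calc _ ≤ ρ ^ (n + 1) * (C / ((n : ℝ) + 1) * ‖∑ k ∈ Finset.range (n + 1),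
          (p (n + 1 - k) * gaugeCoeff p q k - gaugeCoeff p q k * q (n + 1 - k))‖) := by
            gcongr
            exact ContinuousLinearMap.le_of_opNorm_le _ h6 _
        _ = C / ((n : ℝ) + 1) * (ρ ^ (n + 1) * ‖∑ k ∈ Finset.range (n + 1),
          (p (n + 1 - k) * gaugeCoeff p q k - gaugeCoeff p q k * q (n + 1 - k))‖) := by ring
        _ ≤ C / ((n : ℝ) + 1) * (2 * M * S) := by gcongr
        _ = _ := by ring
    calc _ ≤ S + C * (2 * M) / ((n : ℝ) + 1) * S := by gcongr
      _ = S * (1 + C * (2 * M) / ((n : ℝ) + 1)) := by ring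
      _ ≤ ‖(1 : 𝔸)‖ * gaugeMajorant (C * (2 * M)) n * (1 + C * (2 * M) / ((n : ℝ) + 1)) := by gcongr
      _ = _ := by ring

/-- A power series satisfying the coefficient recursion solves `z g' = p g - g q`. -/
theorem smul_deriv_tsum_eq [CompleteSpace 𝔸] {p q g : ℕ → 𝔸} {r : ℝ} {z : ℂ} (hz : ‖z‖ < r)
    (hg : Summable fun n => r ^ n * ‖g n‖) (hp : Summable fun n => ‖z ^ n • p n‖)
    (hq : Summable fun n => ‖z ^ n • q n‖)
    (h : ∀ n : ℕ, (n : ℂ) • g n = ∑ kl ∈ antidiagonal n, p kl.1 * g kl.2 -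
      ∑ kl ∈ antidiagonal n, g kl.1 * q kl.2) :
    z • deriv (fun w : ℂ => ∑' n, w ^ n • g n) z =
      (∑' n, z ^ n • p n) * (∑' n, z ^ n • g n) - (∑' n, z ^ n • g n) * ∑' n, z ^ n • q n := by
  have hle : ∀ (n : ℕ) (w : ℂ), w ∈ ball (0 : ℂ) r → ‖w ^ n • g n‖ ≤ r ^ n * ‖g n‖ := by
    intro n w hw
    rw [norm_smul, norm_pow]
    gcongr
    exact (mem_ball_zero_iff.1 hw).le
  have hzb : z ∈ ball (0 : ℂ) r := by simpa using hz
  have hgz : Summable fun n => ‖z ^ n • g n‖ :=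
    hg.of_nonneg_of_le (fun _ => norm_nonneg _) fun n => hle n z hzb
  have hd := (Complex.hasSum_deriv_of_summable_norm hg (fun n => by fun_prop) isOpen_ball hle
    hzb).const_smul z
  rw [tsum_mul_tsum_eq_tsum_sum_antidiagonal_of_summable_norm hp hgz,
    tsum_mul_tsum_eq_tsum_sum_antidiagonal_of_summable_norm hgz hq, ← Summable.tsum_sub
    (summable_norm_sum_mul_antidiagonal_of_summable_norm hp hgz).of_norm
    (summable_norm_sum_mul_antidiagonal_of_summable_norm hgz hq).of_norm, ← hd.tsum_eq]
  congr 1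
  ext1 n
  have h1 : ∀ f f' : ℕ → 𝔸, ∑ kl ∈ antidiagonal n, z ^ kl.1 • f kl.1 * z ^ kl.2 • f' kl.2 =
      z ^ n • ∑ kl ∈ antidiagonal n, f kl.1 * f' kl.2 := by
    intro f f'
    rw [Finset.smul_sum]
    refine Finset.sum_congr rfl fun kl hkl => ?_
    rw [smul_mul_smul_comm, ← pow_add, Finset.HasAntidiagonal.mem_antidiagonal.1 hkl]
  rw [h1, h1, ← smul_sub, ← h, deriv_smul_const (by fun_prop)]
  rw [smul_smul, smul_smul]
  congr 1
  cases n with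
  | zero => simp
  | succ n => rw [deriv_pow_field, Nat.add_sub_cancel, pow_succ]; ring

/-- Uniqueness for `z k' = P k - k Q` when `x ↦ n x - (a x - x a)`, `a = P(0) = Q(0)`, is injective
for all `n ≥ 1`. -/
theorem eqOn_zero_of_smul_deriv_eq [CompleteSpace 𝔸] {P Q k : ℂ → 𝔸} {R : ℝ} (hR : 0 < R)
    (hP : ContinuousAt P 0)
    (hQ : ContinuousAt Q 0) (hPQ : P 0 = Q 0) (hu : ∀ n, 1 ≤ n → IsUnit (adShift n (P 0)))
    (hk : AnalyticOnNhd ℂ k (ball 0 R)) (hk0 : k 0 = 0)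
    (hode : ∀ z ∈ ball (0 : ℂ) R, z • deriv k z = P z * k z - k z * Q z) :
    EqOn k 0 (ball 0 R) := by
  have h0 : (0 : ℂ) ∈ ball (0 : ℂ) R := mem_ball_self hR
  refine hk.eqOn_zero_of_preconnected_of_eventuallyEq_zero
    (convex_ball (0 : ℂ) R).isPreconnected h0 ?_
  by_contra hne
  obtain ⟨n, u, hua, hu0, hku⟩ := (hk 0 h0).exists_eventuallyEq_pow_smul_nonzero_iff.2 hne
  simp only [sub_zero] at hku
  have hn : 1 ≤ n := by
    rcases Nat.eq_zero_or_pos n with rfl | h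
    · have := hku.self_of_nhds
      simp [hk0] at this
      exact absurd this.symm hu0
    · exact h
  have hev : ∀ᶠ z in 𝓝[≠] (0 : ℂ), (n : ℂ) • u z + z • deriv u z - (P z * u z - u z * Q z) = 0 := by
    filter_upwards [self_mem_nhdsWithin, nhdsWithin_le_nhds hku.eventually_nhds,
      nhdsWithin_le_nhds hua.eventually_analyticAt,
      nhdsWithin_le_nhds (isOpen_ball.mem_nhds h0)] with z hz0 hkz huz hzR
    have hz0' : z ≠ 0 := hz0
    have hde : deriv k z = (z ^ n) • deriv u z + ((n : ℂ) * z ^ (n - 1)) • u z := by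
      rw [Filter.EventuallyEq.deriv_eq (f := fun z => z ^ n • u z) hkz,
        deriv_fun_smul (by fun_prop) huz.differentiableAt]
      simp
    have h1 := hode z hzR
    rw [hde, hkz.self_of_nhds, mul_smul_comm, smul_mul_assoc, ← smul_sub, smul_add, smul_smul,
      smul_smul] at h1
    have h2 : z * ((n : ℂ) * z ^ (n - 1)) = z ^ n * n := by
      obtain ⟨m, rfl⟩ := Nat.exists_eq_add_of_le' hn
      simp [pow_succ]; ring
    rw [h2, mul_comm z, mul_smul, mul_smul, ← smul_add] at h1
    have h3 := smul_right_injective 𝔸 (pow_ne_zero n hz0') h1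
    rw [← h3]
    abel
  have hcont : ContinuousAt
      (fun z => (n : ℂ) • u z + z • deriv u z - (P z * u z - u z * Q z)) 0 := by
    have := hua.continuousAt
    have := hua.deriv.continuousAt
    fun_prop
  have hz : (n : ℂ) • u 0 - (P 0 * u 0 - u 0 * P 0) = 0 := by
    have h1 : Tendsto (fun z => (n : ℂ) • u z + z • deriv u z - (P z * u z - u z * Q z)) (𝓝[≠] 0)
        (𝓝 0) := tendsto_const_nhds.congr' (hev.mono fun z hz => hz.symm)
    have := tendsto_nhds_unique (hcont.tendsto.mono_left nhdsWithin_le_nhds) h1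
    simpa [← hPQ] using this
  rw [← adShift_apply] at hz
  apply hu0
  rw [← Ring.inverse_adShift_apply_adShift (hu n hn) (u 0), hz, map_zero]

theorem smul_deriv_mul_sub_one {a b : 𝔸} {g k : ℂ → 𝔸} {z : ℂ} (hg : DifferentiableAt ℂ g z)
    (hk : DifferentiableAt ℂ k z) (hg' : z • deriv g z = a * g z - g z * b)
    (hk' : z • deriv k z = b * k z - k z * a) :
    z • deriv (fun w => g w * k w - 1) z = a * (g z * k z - 1) - (g z * k z - 1) * a := by
  rw [deriv_sub_const, deriv_fun_mul hg hk, smul_add, ← smul_mul_assoc, ← mul_smul_comm, hg', hk']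
  simp only [sub_mul, mul_sub, mul_assoc, mul_one, one_mul]
  abel

end Gauge

section TaylorCoeff

open Metric Topology Set Filter

variable {E : Type*} [NormedAddCommGroup E] [NormedSpace ℂ E]

/-- The Taylor coefficients at `z = 0` of `F(t, z)`. -/
noncomputable def taylorCoeff {V : Type*} (F : V × ℂ → E) (n : ℕ) (t : V) : E :=
  (n.factorial : ℂ)⁻¹ • iteratedDeriv n (fun z => F (t, z)) 0

theorem taylorCoeff_zero {V : Type*} (F : V × ℂ → E) (t : V) : taylorCoeff F 0 t = F (t, 0) := by
  simp [taylorCoeff]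

variable {V : Type*} [NormedAddCommGroup V] [NormedSpace ℂ V]

theorem AnalyticAt.comp_prodMk_right {F : V × ℂ → E} {t : V} {z : ℂ}
    (h : AnalyticAt ℂ F (t, z)) : AnalyticAt ℂ (fun w => F (t, w)) z :=
  AnalyticAt.comp (f := fun w => (t, w)) h (analyticAt_const.prod analyticAt_id)

theorem AnalyticOnNhd.differentiableOn_prodMk_right {F : V × ℂ → E} {U : Set V} {S : Set ℂ}
    (hF : AnalyticOnNhd ℂ F (U ×ˢ S)) {t : V} (ht : t ∈ U) :
    DifferentiableOn ℂ (fun z => F (t, z)) S := fun z hz =>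
  (hF (t, z) ⟨ht, hz⟩).comp_prodMk_right.differentiableAt.differentiableWithinAt

theorem AnalyticOnNhd.iteratedDeriv_snd [CompleteSpace E] {F : V × ℂ → E} {S : Set (V × ℂ)}
    (hF : AnalyticOnNhd ℂ F S) (n : ℕ) :
    AnalyticOnNhd ℂ (fun p : V × ℂ => iteratedDeriv n (fun z => F (p.1, z)) p.2) S := by
  induction n with
  | zero => simpa using hF
  | succ n ih =>
    intro p hp
    have h1 : AnalyticAt ℂ (fun p => fderiv ℂ
        (fun p : V × ℂ => iteratedDeriv n (fun z => F (p.1, z)) p.2) p (0, 1)) p :=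
      ((ContinuousLinearMap.apply ℂ E ((0, 1) : V × ℂ)).analyticAt _).comp (f := fderiv ℂ
        fun p : V × ℂ => iteratedDeriv n (fun z => F (p.1, z)) p.2) (ih p hp).fderiv
    refine h1.congr ?_
    filter_upwards [(ih p hp).eventually_analyticAt] with ⟨t, z⟩ hx
    rw [iteratedDeriv_succ]
    have h2 := hx.differentiableAt.hasFDerivAt.comp_hasDerivAt (f := fun w : ℂ => (t, w)) z
      ((hasDerivAt_const z t).prodMk (hasDerivAt_id z))
    exact h2.deriv.symm

variable [CompleteSpace E] {F : V × ℂ → E} {U : Set V} {R : ℝ}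

theorem AnalyticOnNhd.taylorCoeff (hR : 0 < R) (hF : AnalyticOnNhd ℂ F (U ×ˢ ball 0 R)) (n : ℕ) :
    AnalyticOnNhd ℂ (taylorCoeff F n) U := fun t ht =>
  AnalyticAt.const_smul <| AnalyticAt.comp (f := fun t : V => (t, (0 : ℂ)))
    (hF.iteratedDeriv_snd n (t, 0) ⟨ht, mem_ball_self hR⟩) (analyticAt_id.prod analyticAt_const)

theorem hasSum_taylorCoeff (hF : AnalyticOnNhd ℂ F (U ×ˢ ball 0 R)) {t : V} (ht : t ∈ U) {z : ℂ}
    (hz : z ∈ ball (0 : ℂ) R) : HasSum (fun n => z ^ n • taylorCoeff F n t) (F (t, z)) := by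
  have := Complex.hasSum_taylorSeries_on_ball (hF.differentiableOn_prodMk_right ht) hz
  simp only [sub_zero] at this
  simpa only [taylorCoeff, smul_comm (z ^ _)] using this

theorem exists_eventually_norm_taylorCoeff_le (hU : IsOpen U)
    (hF : AnalyticOnNhd ℂ F (U ×ˢ ball 0 R)) {t₀ : V} (ht₀ : t₀ ∈ U) {ρ : ℝ} (hρ : 0 < ρ)
    (hρR : ρ < R) : ∃ M : ℝ, 0 ≤ M ∧ ∀ᶠ t in 𝓝 t₀, ∀ n, ‖taylorCoeff F n t‖ ≤ M / ρ ^ n := by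
  have hsub : sphere (0 : ℂ) ρ ⊆ ball 0 R := sphere_subset_ball hρR
  obtain ⟨M, hM⟩ := (isCompact_sphere (0 : ℂ) ρ).exists_bound_of_continuousOn
    ((hF.differentiableOn_prodMk_right ht₀).continuousOn.mono hsub)
  refine ⟨|M| + 1, by positivity, ?_⟩
  have h1 : ∀ᶠ t in 𝓝 t₀, ∀ z ∈ sphere (0 : ℂ) ρ, ‖F (t, z)‖ ≤ |M| + 1 := by
    refine (isCompact_sphere (0 : ℂ) ρ).eventually_forall_of_forall_eventually fun z hz => ?_
    refine ((hF (t₀, z) ⟨ht₀, hsub hz⟩).continuousAt.norm.eventually_lt_const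
      (lt_of_le_of_lt ((hM z hz).trans (le_abs_self M)) (lt_add_one _))).mono fun x hx => ?_
    exact hx.le
  filter_upwards [h1, hU.mem_nhds ht₀] with t ht htU n
  have h2 := Complex.norm_iteratedDeriv_le_of_forall_mem_sphere_norm_le n hρ
    (((hF.differentiableOn_prodMk_right htU).mono (closure_ball_subset_closedBall.trans
      (closedBall_subset_ball hρR))).diffContOnCl) ht
  have hfac : (0 : ℝ) < n.factorial := by exact_mod_cast n.factorial_pos
  rw [_root_.taylorCoeff, norm_smul, norm_inv, Complex.norm_natCast, inv_mul_le_iff₀ hfac]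
  exact h2.trans_eq (by ring)

end TaylorCoeff

section GaugeExistence

open Metric Topology Set Filter

variable {V 𝔸 : Type*} [NormedAddCommGroup V] [NormedSpace ℂ V] [NormedRing 𝔸] [NormedAlgebra ℂ 𝔸]
  [CompleteSpace 𝔸]

theorem analyticAt_gaugeCoeff {p q : ℕ → V → 𝔸} {t : V} (hp : ∀ n, AnalyticAt ℂ (p n) t)
    (hq : ∀ n, AnalyticAt ℂ (q n) t) (hu : ∀ n, 1 ≤ n → IsUnit (adShift n (p 0 t))) (n : ℕ) :
    AnalyticAt ℂ (fun t => gaugeCoeff (fun n => p n t) (fun n => q n t) n) t := by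
  induction n using Nat.strong_induction_on with
  | _ n ih =>
    cases n with
    | zero => simpa only [gaugeCoeff_zero] using analyticAt_const
    | succ n =>
      simp only [gaugeCoeff_succ]
      have h1 : AnalyticAt ℂ (fun t => Ring.inverse (adShift (n + 1) (p 0 t))) t := by
        obtain ⟨u, hu⟩ := hu (n + 1) (by lia)
        have h2 := analyticAt_inverse (𝕜 := ℂ) u
        rw [hu] at h2
        exact AnalyticAt.comp (f := fun t => adShift (n + 1) (p 0 t)) h2
          (AnalyticAt.comp (f := p 0) (analyticAt_adShift (n + 1) (p 0 t)) (hp 0))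
      have h2 : AnalyticAt ℂ (fun t => ∑ k ∈ Finset.range (n + 1),
          (p (n + 1 - k) t * gaugeCoeff (fun n => p n t) (fun n => q n t) k -
            gaugeCoeff (fun n => p n t) (fun n => q n t) k * q (n + 1 - k) t)) t :=
        Finset.analyticAt_fun_sum _ fun k hk =>
          have hk' := ih k (Finset.mem_range.1 hk)
          ((hp _).mul hk').sub (hk'.mul (hq _))
      exact AnalyticAt.comp₂ (h := fun x : (𝔸 →L[ℂ] 𝔸) × 𝔸 => x.1 x.2)
        ((ContinuousLinearMap.id ℂ (𝔸 →L[ℂ] 𝔸)).analyticAt_bilinear (_, _)) h1 h2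

/-- Analytic solution `g` of `z ∂g/∂z = P g - g Q`, `g(t, 0) = 1`, for `P(t, 0) = Q(t, 0)`
without resonances. -/
theorem exists_analyticOnNhd_gauge [FiniteDimensional ℂ V] {U : Set V} {R : ℝ} (hR : 0 < R)
    (hU : IsOpen U) {P Q : V × ℂ → 𝔸} (hP : AnalyticOnNhd ℂ P (U ×ˢ ball 0 R))
    (hQ : AnalyticOnNhd ℂ Q (U ×ˢ ball 0 R)) (hPQ : ∀ t ∈ U, P (t, 0) = Q (t, 0))
    (hu : ∀ t ∈ U, ∀ n, 1 ≤ n → IsUnit (adShift n (P (t, 0)))) :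
    ∃ g : V × ℂ → 𝔸, AnalyticOnNhd ℂ g (U ×ˢ ball 0 R) ∧ ∀ t ∈ U, g (t, 0) = 1 ∧
      ∀ z ∈ ball (0 : ℂ) R,
        z • deriv (fun w => g (t, w)) z = P (t, z) * g (t, z) - g (t, z) * Q (t, z) := by
  set c : V → ℕ → 𝔸 := fun t =>
    gaugeCoeff (fun n => taylorCoeff P n t) (fun n => taylorCoeff Q n t)
  have hu' : ∀ t ∈ U, ∀ n, 1 ≤ n → IsUnit (adShift n (taylorCoeff P 0 t)) := by
    simpa only [taylorCoeff_zero] using hu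
  have hbound : ∀ t₀ ∈ U, ∀ r, 0 < r → r < R → ∃ b : ℕ → ℝ, Summable b ∧
      ∀ᶠ t in 𝓝 t₀, ∀ n, r ^ n * ‖c t n‖ ≤ b n := by
    intro t₀ ht₀ r hr hrR
    obtain ⟨ρ, hrρ, hρR⟩ := exists_between hrR
    have hρ := hr.trans hrρ
    obtain ⟨M₁, hM₁, h₁⟩ := exists_eventually_norm_taylorCoeff_le hU hP ht₀ hρ hρR
    obtain ⟨M₂, hM₂, h₂⟩ := exists_eventually_norm_taylorCoeff_le hU hQ ht₀ hρ hρR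
    obtain ⟨C, hC, h₃⟩ := exists_eventually_isUnit_adShift (hu' t₀ ht₀)
    have hM : 0 ≤ max M₁ M₂ := hM₁.trans (le_max_left _ _)
    refine ⟨_, (summable_gaugeMajorant (D := C * (2 * max M₁ M₂)) (x := r / ρ) (by positivity)
      (by positivity) ((div_lt_one hρ).2 hrρ)).mul_left ‖(1 : 𝔸)‖, ?_⟩
    filter_upwards [h₁, h₂, (hP.taylorCoeff hR 0 t₀ ht₀).continuousAt.eventually h₃]
      with t h₁ h₂ h₃ n
    have h := norm_gaugeCoeff_le hC hM hρ
      (fun n => (h₁ n).trans (by gcongr; exact le_max_left _ _))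
      (fun n => (h₂ n).trans (by gcongr; exact le_max_right _ _)) (fun n hn => (h₃ n hn).2) n
    calc r ^ n * ‖c t n‖ = (r / ρ) ^ n * (ρ ^ n * ‖c t n‖) := by
          rw [div_pow]; field_simp
      _ ≤ (r / ρ) ^ n * (‖(1 : 𝔸)‖ * gaugeMajorant (C * (2 * max M₁ M₂)) n) := by gcongr
      _ = _ := by ring
  have hsummable : ∀ (H : V × ℂ → 𝔸), AnalyticOnNhd ℂ H (U ×ˢ ball 0 R) → ∀ t ∈ U,
      ∀ z ∈ ball (0 : ℂ) R, Summable fun n => ‖z ^ n • taylorCoeff H n t‖ := by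
    intro H hH t ht z hz
    obtain ⟨ρ, hzρ, hρR⟩ := exists_between (mem_ball_zero_iff.1 hz)
    have hρ := (norm_nonneg z).trans_lt hzρ
    obtain ⟨M, hM, h⟩ := exists_eventually_norm_taylorCoeff_le hU hH ht hρ hρR
    refine Summable.of_nonneg_of_le (fun _ => norm_nonneg _) (fun n => ?_)
      ((summable_geometric_of_lt_one (by positivity) ((div_lt_one hρ).2 hzρ)).mul_left M)
    rw [norm_smul, norm_pow]
    calc ‖z‖ ^ n * ‖taylorCoeff H n t‖ ≤ ‖z‖ ^ n * (M / ρ ^ n) := by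
          gcongr
          exact h.self_of_nhds n
      _ = _ := by rw [div_pow]; ring
  refine ⟨fun x => ∑' n, x.2 ^ n • c x.1 n, ?_, fun t ht => ⟨?_, fun z hz => ?_⟩⟩
  · rintro ⟨t₀, z₀⟩ ⟨ht₀, hz₀⟩
    obtain ⟨r, hzr, hrR⟩ := exists_between (mem_ball_zero_iff.1 hz₀)
    obtain ⟨b, hb, hev⟩ := hbound t₀ ht₀ r ((norm_nonneg _).trans_lt hzr) hrR
    obtain ⟨δ, hδ, hδU⟩ := Metric.eventually_nhds_iff_ball.1 (hev.and (hU.mem_nhds ht₀))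
    refine analyticOnNhd_tsum_of_summable_norm (W := ball t₀ δ ×ˢ ball 0 r)
      (isOpen_ball.prod isOpen_ball) (fun n => ?_) hb ?_ (t₀, z₀)
      ⟨mem_ball_self hδ, mem_ball_zero_iff.2 hzr⟩
    · rintro ⟨t, z⟩ ⟨ht, -⟩
      have htU := (hδU t ht).2
      exact (analyticAt_snd.pow n).smul (AnalyticAt.comp (f := Prod.fst) (x := (t, z))
        (analyticAt_gaugeCoeff (fun n => hP.taylorCoeff hR n t htU)
          (fun n => hQ.taylorCoeff hR n t htU) (hu' t htU) n) analyticAt_fst)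
    · rintro n ⟨t, z⟩ ⟨ht, hz⟩
      refine le_trans ?_ ((hδU t ht).1 n)
      rw [norm_smul, norm_pow]
      gcongr
      exact (mem_ball_zero_iff.1 hz).le
  · change ∑' n, (0 : ℂ) ^ n • c t n = 1
    rw [tsum_eq_single 0 fun n hn => by simp [hn]]
    simp [c, gaugeCoeff_zero]
  · obtain ⟨r, hzr, hrR⟩ := exists_between (mem_ball_zero_iff.1 hz)
    have hr := (norm_nonneg z).trans_lt hzr
    obtain ⟨b, hb, hev⟩ := hbound t ht r hr hrR
    have h := smul_deriv_tsum_eq hzr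
      (hb.of_nonneg_of_le (fun n => by positivity) hev.self_of_nhds) (hsummable P hP t ht z hz)
      (hsummable Q hQ t ht z hz)
      (smul_gaugeCoeff (by simpa only [taylorCoeff_zero] using hPQ t ht) (hu' t ht))
    rwa [(hasSum_taylorCoeff hP ht hz).tsum_eq, (hasSum_taylorCoeff hQ ht hz).tsum_eq] at h

end GaugeExistence

section Resonance

variable {X : Type*} [NormedAddCommGroup X] [NormedSpace ℂ X] [FiniteDimensional ℂ X]

theorem ContinuousLinearMap.isUnit_iff_ker_eq_bot {𝕜 : Type*} [NontriviallyNormedField 𝕜]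
    [CompleteSpace 𝕜] {X : Type*} [NormedAddCommGroup X] [NormedSpace 𝕜 X] [FiniteDimensional 𝕜 X]
    {T : X →L[𝕜] X} : IsUnit T ↔ LinearMap.ker T.toLinearMap = ⊥ := by
  have := FiniteDimensional.complete 𝕜 X
  rw [ContinuousLinearMap.isUnit_iff_isUnit_toLinearMap, LinearMap.isUnit_iff_ker_eq_bot]

theorem exists_apply_eq_smul_of_mem_spectrum {a : X →L[ℂ] X} {lam : ℂ} (h : lam ∈ spectrum ℂ a) :
    ∃ v, v ≠ 0 ∧ a v = lam • v := by
  rw [spectrum.mem_iff, ContinuousLinearMap.isUnit_iff_ker_eq_bot] at h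
  obtain ⟨v, hv, hv0⟩ := Submodule.exists_mem_ne_zero_of_ne_bot h
  refine ⟨v, hv0, ?_⟩
  have : lam • v - a v = 0 := by simpa [Algebra.algebraMap_eq_smul_one] using hv
  exact (sub_eq_zero.1 this).symm

theorem exists_comp_eq_smul_of_mem_spectrum {a : X →L[ℂ] X} {mu : ℂ} (h : mu ∈ spectrum ℂ a) :
    ∃ l : X →L[ℂ] ℂ, l ≠ 0 ∧ ∀ x, l (a x) = mu * l x := by
  rw [spectrum.mem_iff, ContinuousLinearMap.isUnit_iff_isUnit_toLinearMap,
    LinearMap.isUnit_iff_range_eq_top] at h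
  obtain ⟨l, hl, hle⟩ := Submodule.exists_le_ker_of_lt_top _ (lt_top_iff_ne_top.2 h)
  refine ⟨LinearMap.toContinuousLinearMap l, by simpa using hl, fun x => ?_⟩
  have : l (mu • x - a x) = 0 := hle ⟨x, by simp [Algebra.algebraMap_eq_smul_one]⟩
  rw [map_sub, map_smul, sub_eq_zero] at this
  exact this.symm

/-- `x ↦ n x - (a x - x a)` is invertible exactly if `n` is not a difference of eigenvalues. -/
theorem isUnit_adShift_iff (n : ℕ) (a : X →L[ℂ] X) :
    IsUnit (adShift n a) ↔ ∀ lam ∈ spectrum ℂ a, ∀ mu ∈ spectrum ℂ a, lam - mu ≠ (n : ℂ) := by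
  rw [ContinuousLinearMap.isUnit_iff_ker_eq_bot]
  constructor
  · intro h lam hlam mu hmu hn
    obtain ⟨v, hv, hav⟩ := exists_apply_eq_smul_of_mem_spectrum hlam
    obtain ⟨l, hl, hla⟩ := exists_comp_eq_smul_of_mem_spectrum hmu
    have h0 : l.smulRight v = 0 := by
      refine (Submodule.eq_bot_iff _).1 h _ ?_
      change adShift n a (l.smulRight v) = 0
      ext x
      simp only [adShift_apply, ← hn, sub_apply, smul_apply, mul_apply_eq_comp,
        ContinuousLinearMap.smulRight_apply, map_smul, hav, hla, zero_apply]
      module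
    obtain ⟨x, hx⟩ := ContinuousLinearMap.exists_ne_zero hl
    exact smul_ne_zero hx hv (DFunLike.congr_fun h0 x)
  · intro h
    by_contra hK
    set K := LinearMap.ker (adShift n a).toLinearMap
    have hmem : ∀ y, y ∈ K ↔ y * a = a * y - (n : ℂ) • y := fun y => by
      change adShift n a y = 0 ↔ _
      rw [adShift_apply, sub_eq_zero, eq_sub_iff_add_eq, eq_sub_iff_add_eq, add_comm]
    have hmap : ∀ y ∈ K, LinearMap.mulLeft ℂ a y ∈ K := fun y hy => by
      rw [hmem] at hy ⊢
      rw [LinearMap.mulLeft_apply, mul_assoc, hy, mul_sub, mul_smul_comm]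
    have := Submodule.nontrivial_iff_ne_bot.2 hK
    obtain ⟨mu, hmu⟩ := Module.End.exists_eigenvalue ((LinearMap.mulLeft ℂ a).restrict hmap)
    obtain ⟨⟨y, hy⟩, hyv⟩ := hmu.exists_hasEigenvector
    have hay : a * y = mu • y := congrArg Subtype.val hyv.apply_eq_smul
    have hy0 : y ≠ 0 := fun h => hyv.2 (Subtype.ext h)
    have hya := (hmem y).1 hy
    rw [hay, ← sub_smul] at hya
    refine h mu ?_ (mu - n) ?_ (by ring)
    · refine spectrum.mem_iff.2 fun hu => hy0 (hu.mul_right_eq_zero.1 ?_)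
      rw [sub_mul, hay, Algebra.algebraMap_eq_smul_one, smul_mul_assoc, one_mul, sub_self]
    · refine spectrum.mem_iff.2 fun hu => hy0 (hu.mul_left_eq_zero.1 ?_)
      rw [mul_sub, hya, Algebra.algebraMap_eq_smul_one, mul_smul_comm, mul_one, sub_self]

end Resonance

/-- Analytic reduction of the ODE `f′ = (F(t,z)/z) f` to `f′ = (A₀(t)/z) f` by a gauge
transformation `g(t,z)`, analytic in `(t,z)`, invertible, with `g(t,0) = 1`, unique for
each fixed `t`. -/
theorem analytic_gauge_reduction (m d : ℕ) (hm : 1 ≤ m) (hd : 1 ≤ d)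
    (R : ℝ) (hR : 0 < R)
    (F : ((Fin m → ℂ) × ℂ) → ((Fin d → ℂ) →L[ℂ] (Fin d → ℂ)))
    (hF : AnalyticOnNhd ℂ F (Set.univ ×ˢ Metric.ball (0 : ℂ) R)) :
    IsOpen (goodParams m d F) ∧
    ∃ g : ((Fin m → ℂ) × ℂ) → ((Fin d → ℂ) →L[ℂ] (Fin d → ℂ)),
      AnalyticOnNhd ℂ g (goodParams m d F ×ˢ Metric.ball (0 : ℂ) R) ∧
      ∀ t ∈ goodParams m d F,
        g (t, 0) = 1 ∧
        (∀ z ∈ Metric.ball (0 : ℂ) R, IsUnit (g (t, z)) ∧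
          z • deriv (fun w => g (t, w)) z = F (t, z) * g (t, z) - g (t, z) * F (t, 0)) ∧
        (∀ h : ℂ → ((Fin d → ℂ) →L[ℂ] (Fin d → ℂ)),
          AnalyticOnNhd ℂ h (Metric.ball (0 : ℂ) R) → h 0 = 1 →
          (∀ z ∈ Metric.ball (0 : ℂ) R,
            z • deriv h z = F (t, z) * h z - h z * F (t, 0)) →
          ∀ z ∈ Metric.ball (0 : ℂ) R, h z = g (t, z)) := by
  have h0 : (0 : ℂ) ∈ Metric.ball (0 : ℂ) R := Metric.mem_ball_self hR
  have hA : AnalyticOnNhd ℂ (fun t => F (t, 0)) Set.univ := fun t _ =>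
    AnalyticAt.comp (f := fun t : Fin m → ℂ => (t, (0 : ℂ))) (hF (t, 0) ⟨trivial, h0⟩)
      (analyticAt_id.prod analyticAt_const)
  have hgood : ∀ t, t ∈ goodParams m d F ↔ ∀ n, 1 ≤ n → IsUnit (adShift n (F (t, 0))) := by
    intro t
    simp only [isUnit_adShift_iff]
    exact ⟨fun h n hn lam hlam mu hmu => h lam hlam mu hmu n hn,
      fun h lam hlam mu hmu n hn => h n hn lam hlam mu hmu⟩
  have hopen : IsOpen (goodParams m d F) := by
    refine isOpen_iff_mem_nhds.2 fun t ht => ?_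
    obtain ⟨C, -, hC⟩ := exists_eventually_isUnit_adShift ((hgood t).1 ht)
    filter_upwards [(hA t trivial).continuousAt.eventually hC] with s hs
    exact (hgood s).2 fun n hn => (hs n hn).1
  have hF' : AnalyticOnNhd ℂ F (goodParams m d F ×ˢ Metric.ball (0 : ℂ) R) :=
    hF.mono (Set.prod_mono_left (Set.subset_univ _))
  have hA' : AnalyticOnNhd ℂ (fun x : (Fin m → ℂ) × ℂ => F (x.1, 0))
      (goodParams m d F ×ˢ Metric.ball (0 : ℂ) R) := fun x _ =>
    AnalyticAt.comp (f := Prod.fst) (hA x.1 trivial) analyticAt_fst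
  obtain ⟨g, hg, hg'⟩ := exists_analyticOnNhd_gauge hR hopen hF' hA' (fun _ _ => rfl)
    fun t ht => (hgood t).1 ht
  obtain ⟨k, hk, hk'⟩ := exists_analyticOnNhd_gauge hR hopen hA' hF' (fun _ _ => rfl)
    fun t ht => (hgood t).1 ht
  refine ⟨hopen, g, hg, fun t ht => ?_⟩
  obtain ⟨hg0, hgode⟩ := hg' t ht
  obtain ⟨hk0, hkode⟩ := hk' t ht
  have hgt : AnalyticOnNhd ℂ (fun z => g (t, z)) (Metric.ball 0 R) := fun z hz =>
    (hg (t, z) ⟨ht, hz⟩).comp_prodMk_right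
  have hkt : AnalyticOnNhd ℂ (fun z => k (t, z)) (Metric.ball 0 R) := fun z hz =>
    (hk (t, z) ⟨ht, hz⟩).comp_prodMk_right
  have hFc : ContinuousAt (fun z => F (t, z)) 0 :=
    (hF (t, 0) ⟨trivial, h0⟩).comp_prodMk_right.continuousAt
  refine ⟨hg0, fun z hz => ⟨?_, hgode z hz⟩, fun h hh hh0 hhode z hz => ?_⟩
  · have hgk := eqOn_zero_of_smul_deriv_eq (k := fun z => g (t, z) * k (t, z) - 1) hR hFc hFc rfl
      ((hgood t).1 ht) ((hgt.mul hkt).sub analyticOnNhd_const) (by simp [hg0, hk0])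
      (fun z hz => smul_deriv_mul_sub_one (hgt z hz).differentiableAt (hkt z hz).differentiableAt
        (hgode z hz) (hkode z hz)) hz
    have hkg := eqOn_zero_of_smul_deriv_eq (k := fun z => k (t, z) * g (t, z) - 1) hR
      (continuousAt_const (y := F (t, 0))) continuousAt_const rfl
      ((hgood t).1 ht) ((hkt.mul hgt).sub analyticOnNhd_const) (by simp [hg0, hk0])
      (fun z hz => smul_deriv_mul_sub_one (hkt z hz).differentiableAt (hgt z hz).differentiableAt
        (hkode z hz) (hgode z hz)) hz
    exact ⟨⟨g (t, z), k (t, z), sub_eq_zero.1 hgk, sub_eq_zero.1 hkg⟩, rfl⟩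
  · refine sub_eq_zero.1 (eqOn_zero_of_smul_deriv_eq (k := fun z => h z - g (t, z)) hR hFc
      (continuousAt_const (y := F (t, 0))) rfl ((hgood t).1 ht) (hh.sub hgt)
      (by simp [hg0, hh0]) (fun z hz => ?_) hz)
    rw [deriv_fun_sub (hh z hz).differentiableAt (hgt z hz).differentiableAt, smul_sub,
      hhode z hz, hgode z hz]
    simp only [sub_mul, mul_sub]
    abel
end

section
/- Let V be a finite-dimensional complex vector space, P ∈ End(V), φ a linear functional on V, v ∈ V, and Q ∈ End(V) the operator Qx = φ(x)v. For t ∈ ℂ with t·1 − P invertible set χ_P(t) = 1 + φ((t·1 − P)⁻¹ v), so that Q + Q(t·1−P)⁻¹Q = χ_P(t)·Q. Let R = Q − P and define χ_R analogously. Then for every t ∈ ℂ such that both t·1 − R and −t·1 − P are invertible, χ_R(t) · χ_P(−t) = 1; i.e. (1 + φ((t·1−R)⁻¹v)) · (1 + φ((−t·1−P)⁻¹v)) = 1. -/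
/-- Inversion lemma: with `R = Q - P` and `Qx = φ(x)v`, one has
`χ_R(t) · χ_P(−t) = 1` wherever both resolvents exist. -/
theorem inversion_lemma {V : Type*} [AddCommGroup V] [Module ℂ V] [FiniteDimensional ℂ V]
    (P : Module.End ℂ V) (φ : V →ₗ[ℂ] ℂ) (v : V)
    (Q : Module.End ℂ V) (hQ : ∀ x : V, Q x = φ x • v)
    (R : Module.End ℂ V) (hR : R = Q - P)
    (t : ℂ)
    (hRt : IsUnit (t • (1 : Module.End ℂ V) - R))
    (hPt : IsUnit ((-t) • (1 : Module.End ℂ V) - P)) :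
    (1 + φ ((Ring.inverse (t • (1 : Module.End ℂ V) - R)) v)) *
      (1 + φ ((Ring.inverse ((-t) • (1 : Module.End ℂ V) - P)) v)) = 1 := by
  subst hR
  set A := t • (1 : Module.End ℂ V) - (Q - P) with hA
  set B := (-t) • (1 : Module.End ℂ V) - P with hB
  set a := Ring.inverse A v
  set b := Ring.inverse B v
  have hBb : B b = v := LinearMap.congr_fun (Ring.mul_inverse_cancel B hPt) v
  have hAb : A b = -(1 + φ b) • v := by
    have hAB : A b = -B b - Q b := by
      simp only [hA, hB, LinearMap.sub_apply, LinearMap.smul_apply, Module.End.one_apply]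
      module
    rw [hAB, hBb, hQ]
    module
  have hba : b = -(1 + φ b) • a := by
    have hAAb : Ring.inverse A (A b) = b :=
      LinearMap.congr_fun (Ring.inverse_mul_cancel A hRt) b
    rwa [hAb, map_smul, eq_comm] at hAAb
  have hφ : φ b = -(1 + φ b) * φ a := by
    simpa only [map_smul, smul_eq_mul] using congrArg φ hba
  linear_combination hφ
end

section
/- Let V be a finite-dimensional complex vector space, P ∈ End(V), φ a linear functional on V, v ∈ V, and Q ∈ End(V) the operator Qx = φ(x)v. Let λ ∈ ℂ and ξ₀ ∈ V with Pξ₀ = λξ₀. Assume that for every integer n ≥ 1 the operator (λ+n)·1 − P is invertible, and define recursively ξ_n = ((λ+n)·1 − P)⁻¹ Q(ξ₀ + ξ₁ + ⋯ + ξ_{n−1}) for n ≥ 1 (these are the coefficients of the formal power series solution f(z) = Σ ξ_n z^{λ+n} of the ODE f′ = (P/z + Q/(1−z))f). Then for every n ≥ 0: φ(ξ₀ + ξ₁ + ⋯ + ξ_n) = φ(ξ₀) · ∏_{m=1}^{n} χ_P(λ+m), where χ_P(t) = 1 + φ((t·1 − P)⁻¹ v) and the empty product is 1. -/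
/-- Projected power series solutions: the projections of the partial sums of the
formal power series solution `f(z) = Σ ξ_n z^{λ+n}` of `f′ = (P/z + Q/(1−z))f`
satisfy `φ(ξ₀+⋯+ξ_n) = φ(ξ₀)·∏_{m=1}^n χ_P(λ+m)`. -/
theorem projected_solution_recursion
    {V : Type*} [AddCommGroup V] [Module ℂ V] [FiniteDimensional ℂ V]
    (P : Module.End ℂ V) (φ : V →ₗ[ℂ] ℂ) (v : V)
    (Q : Module.End ℂ V) (hQ : ∀ x : V, Q x = φ x • v)
    (lam : ℂ) (ξ₀ : V) (hξ₀ : P ξ₀ = lam • ξ₀)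
    (hinv : ∀ n : ℕ, 1 ≤ n → IsUnit ((lam + (n : ℂ)) • (1 : Module.End ℂ V) - P))
    (ξ : ℕ → V) (hξzero : ξ 0 = ξ₀)
    (hξ : ∀ n : ℕ, 1 ≤ n →
      ξ n = (Ring.inverse ((lam + (n : ℂ)) • (1 : Module.End ℂ V) - P))
        (Q (∑ m ∈ Finset.range n, ξ m))) :
    ∀ n : ℕ, φ (∑ m ∈ Finset.range (n + 1), ξ m) =
      φ ξ₀ * ∏ m ∈ Finset.Icc 1 n,
        (1 + φ ((Ring.inverse ((lam + (m : ℂ)) • (1 : Module.End ℂ V) - P)) v)) := by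
  intro n
  induction n with
  | zero => simp [hξzero]
  | succ n ih =>
    rw [Finset.sum_range_succ, hξ (n + 1) (by lia), hQ, map_add, map_smul, map_smul, smul_eq_mul,
      Finset.prod_Icc_succ_top (by lia), ← mul_assoc, ← ih]
    ring
end

section
/- Fix integers N ≥ 1 and ℓ ≥ 0, set c = N + ℓ, and let δ = (N−1, N−2, …, 1, 0) ∈ ℤ^N. For m ∈ ℤ^N the following are equivalent: (i) the stabiliser of m in W = Λ₀ ⋊ S_N is trivial, i.e. whenever σ ∈ S_N and y ∈ Λ₀ satisfy y + σ·m = m, one has σ = id and y = 0; (ii) there is no transposition τ ∈ S_N with τ·m − m ∈ Λ₀; (iii) there exist σ ∈ S_N, y ∈ Λ₀ and a signature f of length N that is permissible at level ℓ with m = y + σ·(f + δ). Moreover, when these hold, the triple (σ, y, f) in (iii) is unique. -/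
lemma strictAnti_int_gap {N : ℕ} {x : Fin N → ℤ} (hx : StrictAnti x) {i j : Fin N}
    (hij : i ≤ j) : (j : ℤ) - i ≤ x i - x j := by
  obtain ⟨j, hj⟩ := j
  induction j with
  | zero =>
    have : i = ⟨0, hj⟩ := le_antisymm hij (Fin.mk_le_of_le_val (Nat.zero_le _))
    simp [this]
  | succ k ih =>
    rcases hij.eq_or_lt with rfl | h
    · simp
    · have h₁ := ih (by omega) (Fin.mk_le_mk.2 (Nat.lt_succ_iff.1 h))
      have h₂ := hx (show (⟨k, by omega⟩ : Fin N) < ⟨k + 1, hj⟩ from Nat.lt_succ_self k)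
      push_cast at h₁ ⊢
      linarith

/-- Two points with the same coordinate sum, congruent modulo `c` and each of spread less
than `c`, coincide. -/
lemma shift_eq_of_spread_lt {ι : Type*} [Fintype ι] {c : ℤ} (hc : 0 < c) {m y₁ y₂ : ι → ℤ}
    (hy : ∑ i, y₁ i = ∑ i, y₂ i)
    (h₁ : ∀ i j, (m i - c * y₁ i) - (m j - c * y₁ j) < c)
    (h₂ : ∀ i j, (m i - c * y₂ i) - (m j - c * y₂ j) < c) : y₁ = y₂ := by
  by_contra hne
  obtain ⟨k, hk⟩ := Function.ne_iff.1 hne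
  have hex : ∃ i, y₁ i < y₂ i := by
    by_contra! h
    exact hk ((Finset.sum_eq_sum_iff_of_le fun i _ => h i).1 hy.symm k (Finset.mem_univ k)).symm
  have hex' : ∃ i, y₂ i < y₁ i := by
    by_contra! h
    exact hk ((Finset.sum_eq_sum_iff_of_le fun i _ => h i).1 hy k (Finset.mem_univ k))
  obtain ⟨i, hi⟩ := hex
  obtain ⟨j, hj⟩ := hex'
  have := h₁ i j
  have := h₂ j i
  nlinarith

/-- Every integer point can be translated by `c` times a vector of coordinate sum zero so that
its spread becomes at most `c`: minimise the Euclidean norm. -/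
lemma exists_shift_spread_le {ι : Type*} [Fintype ι] {c : ℤ} (hc : 0 < c) (m : ι → ℤ) :
    ∃ y : ι → ℤ, ∑ i, y i = 0 ∧ ∀ i j, (m i - c * y i) - (m j - c * y j) ≤ c := by
  classical
  let φ : (ι → ℤ) → ℕ := fun y => (∑ i, (m i - c * y i) ^ 2).toNat
  have hφ (y) : (φ y : ℤ) = ∑ i, (m i - c * y i) ^ 2 :=
    Int.toNat_of_nonneg (Finset.sum_nonneg fun i _ => sq_nonneg _)
  obtain ⟨y, hy, hmin⟩ := exists_minimalFor_of_wellFoundedLT (fun y : ι → ℤ => ∑ i, y i = 0) φ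
    ⟨0, by simp⟩
  refine ⟨y, hy, fun i j => ?_⟩
  rcases eq_or_ne i j with rfl | hij
  · simpa using hc.le
  let z : ι → ℤ := y + Pi.single i 1 - Pi.single j 1
  have hz : ∑ k, z k = 0 := by
    simp [z, Finset.sum_add_distrib, Finset.sum_sub_distrib, hy, Finset.sum_pi_single']
  have hle : φ y ≤ φ z := (le_total (φ y) (φ z)).elim id fun h => hmin hz h
  have hdiff : ∑ k, (m k - c * z k) ^ 2 = ∑ k, (m k - c * y k) ^ 2 +
      2 * c * (c - ((m i - c * y i) - (m j - c * y j))) := by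
    have hterm (k) : (m k - c * z k) ^ 2 = (m k - c * y k) ^ 2 +
        ((if k = i then c ^ 2 - 2 * c * (m k - c * y k) else 0) +
          if k = j then c ^ 2 + 2 * c * (m k - c * y k) else 0) := by
      simp only [z, Pi.add_apply, Pi.sub_apply, Pi.single_apply]
      split_ifs with h₁ h₂
      · exact absurd (h₁.symm.trans h₂) hij
      all_goals ring
    simp only [hterm, Finset.sum_add_distrib, Finset.sum_ite_eq', Finset.mem_univ, if_true]
    ring
  zify at hle
  rw [hφ, hφ, hdiff] at hle
  refine sub_nonneg.1 (nonneg_of_mul_nonneg_right (le_add_iff_nonneg_right _ |>.1 hle) ?_)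
  linarith

/-- A point with pairwise incongruent coordinates modulo `c` is a translate of a point with
strictly decreasing coordinates of spread less than `c`, up to a permutation. -/
lemma exists_shift_perm_strictAnti {N : ℕ} {c : ℤ} (hc : 0 < c) {m : Fin N → ℤ}
    (hm : ∀ i j, c ∣ m i - m j → i = j) :
    ∃ (σ : Equiv.Perm (Fin N)) (y g : Fin N → ℤ), ∑ i, y i = 0 ∧ StrictAnti g ∧
      (∀ i j, g i - g j < c) ∧ ∀ i, m i = c * y i + g (σ⁻¹ i) := by
  obtain ⟨y, hy, hspread⟩ := exists_shift_spread_le hc m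
  let x : Fin N → ℤ := fun i => m i - c * y i
  have hdvd (i j) (h : c ∣ x i - x j) : i = j := by
    refine hm i j ?_
    have : m i - m j = x i - x j + c * (y i - y j) := by simp only [x]; ring
    exact this ▸ dvd_add h (dvd_mul_right _ _)
  let σ := Tuple.sort (-x)
  have hσ : Antitone (x ∘ σ) := fun i j h => neg_le_neg_iff.1 (Tuple.monotone_sort (-x) h)
  have hinj : Function.Injective (x ∘ σ) := fun i j h =>
    σ.injective (hdvd _ _ (by simp [show x (σ i) = x (σ j) from h]))
  refine ⟨σ, y, x ∘ σ, hy, hσ.strictAnti_of_injective hinj, fun i j => ?_, fun i => by simp [x]⟩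
  refine lt_of_le_of_ne (hspread _ _) fun h => ?_
  have hij : σ i = σ j := hdvd _ _ (by simp only [Function.comp_apply] at h; rw [h])
  simp only [Function.comp_apply, hij, sub_self] at h
  exact hc.ne h

/-- Adding the staircase to an antitone vector of spread at most `ℓ` gives strictly decreasing
coordinates of spread less than `N + ℓ`. -/
lemma antitone_add_staircase {N ℓ : ℕ} {f : Fin N → ℤ} (hf : Antitone f)
    (hℓ : ∀ i j, f i - f j ≤ (ℓ : ℤ)) :
    StrictAnti (fun i : Fin N => f i + ((N : ℤ) - 1 - (i : ℕ))) ∧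
      ∀ i j : Fin N, (f i + ((N : ℤ) - 1 - (i : ℕ))) - (f j + ((N : ℤ) - 1 - (j : ℕ))) <
        (N : ℤ) + ℓ := by
  refine ⟨fun i j h => ?_, fun i j => ?_⟩
  · have := hf h.le
    have : (i : ℕ) < j := h
    dsimp only
    omega
  · have := hℓ i j
    omega

/-- Characterisation of the points of `ℤ^N` with trivial stabiliser in the affine Weyl
group `W = Λ₀ ⋊ S_N`: they are exactly the points `y + σ·(f + δ)` with `f` a
permissible signature, and then `(σ, y, f)` is unique; the points with non-trivial
stabiliser are exactly those moved into themselves by a transposition modulo `Λ₀`. -/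
theorem affine_weyl_trivial_stabiliser (N ℓ : ℕ) (hN : 1 ≤ N) (m : Fin N → ℤ) :
    let c : ℤ := (N : ℤ) + ℓ
    let δ : Fin N → ℤ := fun i => (N : ℤ) - 1 - (i : ℕ)
    let TrivStab : Prop := ∀ (σ : Equiv.Perm (Fin N)) (y : Fin N → ℤ),
      (∑ i, y i) = 0 → (∀ i, c * y i + m (σ⁻¹ i) = m i) → σ = 1 ∧ y = 0
    let NoTransp : Prop := ¬ ∃ (i j : Fin N), i ≠ j ∧ ∃ y : Fin N → ℤ,
      (∑ k, y k) = 0 ∧ ∀ k, m (Equiv.swap i j k) - m k = c * y k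
    let RegForm : (Equiv.Perm (Fin N)) → (Fin N → ℤ) → (Fin N → ℤ) → Prop :=
      fun σ y f =>
        (∑ i, y i) = 0 ∧ (∀ i j : Fin N, i ≤ j → f j ≤ f i) ∧
        f ⟨0, by omega⟩ - f ⟨N - 1, by omega⟩ ≤ (ℓ : ℤ) ∧
        ∀ i, m i = c * y i + (f (σ⁻¹ i) + δ (σ⁻¹ i))
    (TrivStab ↔ NoTransp) ∧
    (TrivStab ↔ ∃ (σ : Equiv.Perm (Fin N)) (y f : Fin N → ℤ), RegForm σ y f) ∧
    (TrivStab → ∀ (σ₁ σ₂ : Equiv.Perm (Fin N)) (y₁ y₂ f₁ f₂ : Fin N → ℤ),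
      RegForm σ₁ y₁ f₁ → RegForm σ₂ y₂ f₂ → σ₁ = σ₂ ∧ y₁ = y₂ ∧ f₁ = f₂) := by
  intro c δ TrivStab NoTransp RegForm
  have hc : 0 < c := by simp only [c]; omega
  have staircase (σ y f) (h : RegForm σ y f) := antitone_add_staircase (ℓ := ℓ)
    (fun i j hij => h.2.1 i j hij) fun i j =>
      (sub_le_sub (h.2.1 _ i (Fin.mk_le_of_le_val (Nat.zero_le _)))
        (h.2.1 j _ (Fin.le_def.2 (Nat.le_sub_one_of_lt j.2)))).trans h.2.2.1
  have trivStab_iff : TrivStab ↔ ∀ i j, c ∣ m i - m j → i = j := by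
    refine ⟨fun h i j ⟨d, hd⟩ => ?_, fun h σ y _ hm => ?_⟩
    · by_contra hij
      refine hij (Equiv.swap_eq_one_iff.1
        (h (Equiv.swap i j) (Pi.single i d - Pi.single j d) ?_ fun k => ?_).1)
      · simp [Finset.sum_sub_distrib, Finset.sum_pi_single']
      · rw [Equiv.swap_inv]
        rcases eq_or_ne k i with rfl | hi
        · simp [hij, ← hd]
        rcases eq_or_ne k j with rfl | hj
        · simp [hi, ← hd]
        · simp [hi, hj, Equiv.swap_apply_of_ne_of_ne]
    · have hσ : σ = 1 := by
        rw [← inv_eq_one]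
        ext1 i
        exact (h i _ ⟨y i, by linarith [hm i]⟩).symm
      subst hσ
      exact ⟨rfl, funext fun i => by simpa [hc.ne'] using hm i⟩
  have noTransp_iff : NoTransp ↔ ∀ i j, c ∣ m i - m j → i = j := by
    refine ⟨fun h i j ⟨d, hd⟩ => ?_, fun h ⟨i, j, hij, y, _, hm⟩ => ?_⟩
    · by_contra hij
      refine h ⟨i, j, hij, Pi.single j d - Pi.single i d, ?_, fun k => ?_⟩
      · simp [Finset.sum_sub_distrib, Finset.sum_pi_single']
      · rcases eq_or_ne k i with rfl | hi
        · simp [hij, ← hd]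
        rcases eq_or_ne k j with rfl | hj
        · simp [hi, ← hd]
        · simp [hi, hj, Equiv.swap_apply_of_ne_of_ne]
    · have := hm j
      rw [Equiv.swap_apply_right] at this
      exact hij (h i j ⟨y j, this⟩)
  refine ⟨trivStab_iff.trans noTransp_iff.symm, trivStab_iff.trans ⟨fun h => ?_, ?_⟩, ?_⟩
  · obtain ⟨σ, y, g, hy, hg, hspread, hm⟩ := exists_shift_perm_strictAnti hc h
    refine ⟨σ, y, g - δ, hy, fun i j hij => ?_, ?_, fun i => by simpa using hm i⟩
    · have := strictAnti_int_gap hg hij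
      simp only [Pi.sub_apply, δ]
      linarith
    · have := hspread ⟨0, by omega⟩ ⟨N - 1, by omega⟩
      simp only [Pi.sub_apply, δ, c] at this ⊢
      omega
  · rintro ⟨σ, y, f, h⟩ i j hij
    have hm := h.2.2.2
    obtain ⟨hanti, hspread⟩ := staircase σ y f h
    have hdvd : c ∣ (f (σ⁻¹ i) + δ (σ⁻¹ i)) - (f (σ⁻¹ j) + δ (σ⁻¹ j)) := by
      rw [hm i, hm j] at hij
      rw [← dvd_add_right (dvd_mul_right c (y i - y j))]
      refine hij.trans (dvd_of_eq ?_)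
      ring
    exact σ⁻¹.injective (hanti.injective (sub_eq_zero.1 (Int.eq_zero_of_abs_lt_dvd hdvd
      (abs_sub_lt_iff.2 ⟨hspread _ _, hspread _ _⟩))))
  · rintro - σ₁ σ₂ y₁ y₂ f₁ f₂ h₁ h₂
    obtain ⟨hanti₁, hspread₁⟩ := staircase σ₁ y₁ f₁ h₁
    obtain ⟨hanti₂, hspread₂⟩ := staircase σ₂ y₂ f₂ h₂
    have hx₁ (i) : m i - c * y₁ i = f₁ (σ₁⁻¹ i) + δ (σ₁⁻¹ i) := by rw [h₁.2.2.2 i]; ring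
    have hx₂ (i) : m i - c * y₂ i = f₂ (σ₂⁻¹ i) + δ (σ₂⁻¹ i) := by rw [h₂.2.2.2 i]; ring
    obtain rfl : y₁ = y₂ := shift_eq_of_spread_lt hc (h₁.1.trans h₂.1.symm)
      (fun i j => by rw [hx₁, hx₁]; exact hspread₁ _ _)
      (fun i j => by rw [hx₂, hx₂]; exact hspread₂ _ _)
    have hcomp : (f₁ + δ) ∘ ⇑σ₁⁻¹ = (f₂ + δ) ∘ ⇑σ₂⁻¹ :=
      funext fun i => (hx₁ i).symm.trans (hx₂ i)
    have hfδ : f₁ + δ = f₂ + δ := by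
      refine (StrictAnti.range_inj hanti₁ hanti₂).1 ?_
      have := congrArg Set.range hcomp
      rwa [(σ₁⁻¹).surjective.range_comp, (σ₂⁻¹).surjective.range_comp] at this
    refine ⟨inv_injective (Equiv.ext fun i => hanti₁.injective ?_), rfl, add_right_cancel hfδ⟩
    have := congrFun hcomp i
    rw [← hfδ] at this
    exact this
end

section
/- Fix integers N ≥ 1, ℓ ≥ 0 and 1 ≤ k ≤ N, and let f and h be signatures of length N that are permissible at level ℓ. Then the number of signatures g permissible at level ℓ with g ≻ f and h ≻_k g equals the number of signatures g permissible at level ℓ with g ≻_k f and h ≻ g (both sets being finite). -/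
/-- `w` is obtained from `u` by adding `r` boxes, no two in the same row. -/
def AddsBoxes {ι : Type*} [Fintype ι] (r : ℕ) (u w : ι → ℤ) : Prop :=
  (∀ i, w i = u i ∨ w i = u i + 1) ∧ ∑ i, (w i - u i) = (r : ℤ)

/-- Decrease along the permutation `σ`, up to the slack `c`. For the cyclic rotation with slack `ℓ`
at the last index this is permissibility at level `ℓ`. -/
def CyclicallyDecreasing {ι : Type*} (σ : Equiv.Perm ι) (c : ι → ℤ) (g : ι → ℤ) : Prop :=
  ∀ i, g (σ i) ≤ g i + c i

/-- A single box in row `a` is compatible with the gap between `f` and `h`. -/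
def IsGapRow {ι : Type*} (f h : ι → ℤ) (a : ι) : Prop :=
  (f a + 1 ≤ h a ∧ h a ≤ f a + 2) ∧ ∀ i, i ≠ a → f i ≤ h i ∧ h i ≤ f i + 1

section

variable {ι : Type*} [Fintype ι] [DecidableEq ι]

theorem addsBoxes_one_iff (u w : ι → ℤ) :
    AddsBoxes 1 u w ↔ ∃ a, w = u + Pi.single a 1 := by
  constructor
  · rintro ⟨hstep, hsum⟩
    obtain ⟨a, ha⟩ : ∃ a, w a = u a + 1 := by
      by_contra! hne
      have hzero : ∑ i, (w i - u i) = 0 :=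
        Finset.sum_eq_zero fun i _ => by have := hstep i; have := hne i; grind
      simp [hzero] at hsum
    refine ⟨a, ?_⟩
    have hnonneg : ∀ i ∈ Finset.univ.erase a, 0 ≤ w i - u i := fun i _ => by
      have := hstep i; lia
    have hrest : ∑ i ∈ Finset.univ.erase a, (w i - u i) = 0 := by
      have := Finset.add_sum_erase Finset.univ (fun i => w i - u i) (Finset.mem_univ a)
      push_cast at hsum
      grind
    rw [Finset.sum_eq_zero_iff_of_nonneg hnonneg] at hrest
    ext i
    by_cases hi : i = a
    · subst hi; simpa using ha
    · have := hrest i (by simp [hi])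
      simp [hi]
      lia
  · rintro ⟨a, rfl⟩
    refine ⟨fun i => ?_, by simp⟩
    by_cases hi : i = a
    · subst hi; simp
    · simp [hi]

theorem addsBoxes_add_single_iff (k : ℕ) (f h : ι → ℤ) (a : ι) :
    AddsBoxes k (f + Pi.single a 1) h ↔ IsGapRow f h a ∧ ∑ i, (h i - f i) = (k : ℤ) + 1 := by
  have hsum : ∑ i, (h i - (f + Pi.single a 1 : ι → ℤ) i) = ∑ i, (h i - f i) - 1 := by
    simp [Finset.sum_sub_distrib, Finset.sum_add_distrib, sub_sub]
  rw [AddsBoxes, hsum, sub_eq_iff_eq_add]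
  refine and_congr_left fun _ => ⟨fun hs => ⟨?_, fun i hi => ?_⟩, fun hs i => ?_⟩
  · have := hs a
    simp at this
    lia
  · have := hs i
    simp [hi] at this
    lia
  · by_cases hi : i = a
    · subst hi
      have := hs.1
      simp
      lia
    · have := hs.2 i hi
      simp [hi]
      lia

theorem addsBoxes_sub_single_iff (k : ℕ) (f h : ι → ℤ) (a : ι) :
    AddsBoxes k f (h - Pi.single a 1) ↔ IsGapRow f h a ∧ ∑ i, (h i - f i) = (k : ℤ) + 1 := by
  rw [← addsBoxes_add_single_iff]
  unfold AddsBoxes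
  refine and_congr (forall_congr' fun i => ?_) ?_
  · simp only [Pi.add_apply, Pi.sub_apply]
    lia
  · simp only [Pi.add_apply, Pi.sub_apply, sub_sub, add_comm]

variable {σ : Equiv.Perm ι} {c f h : ι → ℤ}

omit [Fintype ι] in
theorem not_cyclicallyDecreasing_add_single_iff (hf : CyclicallyDecreasing σ c f) (b : ι) :
    ¬ CyclicallyDecreasing σ c (f + Pi.single (σ b) 1) ↔ σ b ≠ b ∧ f (σ b) = f b + c b := by
  constructor
  · intro hbad
    simp only [CyclicallyDecreasing, not_forall, not_le] at hbad
    obtain ⟨i, hi⟩ := hbad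
    have hfi := hf i
    simp only [Pi.add_apply, Pi.single_apply, EmbeddingLike.apply_eq_iff_eq] at hi
    by_cases hib : i = b
    · subst hib
      by_cases hfix : i = σ i
      · rw [if_pos rfl, if_pos hfix] at hi
        lia
      · rw [if_pos rfl, if_neg hfix] at hi
        exact ⟨Ne.symm hfix, by lia⟩
    · rw [if_neg hib] at hi
      split_ifs at hi <;> lia
  · rintro ⟨hfix, htight⟩ hgood
    have := hgood b
    simp [Ne.symm hfix] at this
    lia

omit [Fintype ι] in
theorem not_cyclicallyDecreasing_sub_single_iff (hh : CyclicallyDecreasing σ c h) (b : ι) :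
    ¬ CyclicallyDecreasing σ c (h - Pi.single b 1) ↔ σ b ≠ b ∧ h (σ b) = h b + c b := by
  constructor
  · intro hbad
    simp only [CyclicallyDecreasing, not_forall, not_le] at hbad
    obtain ⟨i, hi⟩ := hbad
    have hhi := hh i
    simp only [Pi.sub_apply, Pi.single_apply] at hi
    by_cases hib : i = b
    · subst hib
      by_cases hfix : σ i = i
      · rw [if_pos rfl, if_pos hfix] at hi
        lia
      · rw [if_pos rfl, if_neg hfix] at hi
        exact ⟨hfix, by lia⟩
    · rw [if_neg hib] at hi
      split_ifs at hi <;> lia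
  · rintro ⟨hfix, htight⟩ hgood
    have := hgood b
    simp [hfix] at this
    lia

omit [Fintype ι] [DecidableEq ι] in
/-- A gap row blocked above by a tight constraint of `f` corresponds, under `σ`, to a gap row
blocked below by a tight constraint of `h`. -/
theorem isGapRow_and_tight_iff (hf : CyclicallyDecreasing σ c f)
    (hh : CyclicallyDecreasing σ c h) {b : ι} (hb : σ b ≠ b) :
    (IsGapRow f h (σ b) ∧ f (σ b) = f b + c b) ↔ (IsGapRow f h b ∧ h (σ b) = h b + c b) := by
  have hfb := hf b
  have hhb := hh b
  constructor
  · rintro ⟨⟨hrow, hoff⟩, htight⟩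
    have := hoff b hb.symm
    refine ⟨⟨by lia, fun i hi => ?_⟩, by lia⟩
    by_cases his : i = σ b
    · subst his; lia
    · exact hoff i his
  · rintro ⟨⟨hrow, hoff⟩, htight⟩
    have := hoff (σ b) hb
    refine ⟨⟨by lia, fun i hi => ?_⟩, by lia⟩
    by_cases his : i = b
    · subst his; lia
    · exact hoff i his

open Classical in
theorem card_gapRows_add_eq_card_gapRows_sub (hf : CyclicallyDecreasing σ c f)
    (hh : CyclicallyDecreasing σ c h) :
    (Finset.univ.filter fun a => IsGapRow f h a ∧
      CyclicallyDecreasing σ c (f + Pi.single a 1)).card =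
    (Finset.univ.filter fun a => IsGapRow f h a ∧
      CyclicallyDecreasing σ c (h - Pi.single a 1)).card := by
  have hblocked : (Finset.univ.filter fun a => IsGapRow f h a ∧
        ¬ CyclicallyDecreasing σ c (f + Pi.single a 1)).card =
      (Finset.univ.filter fun a => IsGapRow f h a ∧
        ¬ CyclicallyDecreasing σ c (h - Pi.single a 1)).card := by
    symm
    refine Finset.card_equiv σ fun b => ?_
    simp only [Finset.mem_filter, Finset.mem_univ, true_and,
      not_cyclicallyDecreasing_add_single_iff hf, not_cyclicallyDecreasing_sub_single_iff hh]
    have := fun hb => isGapRow_and_tight_iff hf hh (b := b) hb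
    tauto
  have hadd := Finset.card_filter_add_card_filter_not
    (s := Finset.univ.filter (IsGapRow f h))
    (fun a => CyclicallyDecreasing σ c (f + Pi.single a 1))
  have hsub := Finset.card_filter_add_card_filter_not
    (s := Finset.univ.filter (IsGapRow f h))
    (fun a => CyclicallyDecreasing σ c (h - Pi.single a 1))
  simp only [Finset.filter_filter] at hadd hsub
  lia

theorem finite_and_ncard_eq_of_cyclicallyDecreasing (k : ℕ) (hf : CyclicallyDecreasing σ c f)
    (hh : CyclicallyDecreasing σ c h) :
    {g | CyclicallyDecreasing σ c g ∧ AddsBoxes 1 f g ∧ AddsBoxes k g h}.Finite ∧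
    {g | CyclicallyDecreasing σ c g ∧ AddsBoxes k f g ∧ AddsBoxes 1 g h}.Finite ∧
    {g | CyclicallyDecreasing σ c g ∧ AddsBoxes 1 f g ∧ AddsBoxes k g h}.ncard =
    {g | CyclicallyDecreasing σ c g ∧ AddsBoxes k f g ∧ AddsBoxes 1 g h}.ncard := by
  classical
  have hsingle : Function.Injective fun a : ι => (Pi.single a 1 : ι → ℤ) := fun a b hab => by
    by_contra hne
    simpa [hne] using congrFun hab a
  have haddInj : Function.Injective fun a : ι => f + Pi.single a 1 :=
    (add_right_injective f).comp hsingle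
  have hsubInj : Function.Injective fun a : ι => h - Pi.single a 1 :=
    (sub_right_injective (b := h)).comp hsingle
  have hleft : {g | CyclicallyDecreasing σ c g ∧ AddsBoxes 1 f g ∧ AddsBoxes k g h} =
      (fun a => f + Pi.single a 1) '' {a | (IsGapRow f h a ∧
        CyclicallyDecreasing σ c (f + Pi.single a 1)) ∧ ∑ i, (h i - f i) = (k : ℤ) + 1} := by
    ext g
    simp only [Set.mem_ofPred_eq, Set.mem_image, addsBoxes_one_iff]
    constructor
    · rintro ⟨hg, ⟨a, rfl⟩, hk⟩
      rw [addsBoxes_add_single_iff] at hk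
      exact ⟨a, ⟨⟨hk.1, hg⟩, hk.2⟩, rfl⟩
    · rintro ⟨a, ⟨⟨ha, hg⟩, hs⟩, rfl⟩
      exact ⟨hg, ⟨a, rfl⟩, (addsBoxes_add_single_iff ..).2 ⟨ha, hs⟩⟩
  have hright : {g | CyclicallyDecreasing σ c g ∧ AddsBoxes k f g ∧ AddsBoxes 1 g h} =
      (fun a => h - Pi.single a 1) '' {a | (IsGapRow f h a ∧
        CyclicallyDecreasing σ c (h - Pi.single a 1)) ∧ ∑ i, (h i - f i) = (k : ℤ) + 1} := by
    ext g
    simp only [Set.mem_ofPred_eq, Set.mem_image, addsBoxes_one_iff]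
    constructor
    · rintro ⟨hg, hk, a, ha⟩
      obtain rfl := eq_sub_of_add_eq ha.symm
      rw [addsBoxes_sub_single_iff] at hk
      exact ⟨a, ⟨⟨hk.1, hg⟩, hk.2⟩, rfl⟩
    · rintro ⟨a, ⟨⟨ha, hg⟩, hs⟩, rfl⟩
      exact ⟨hg, (addsBoxes_sub_single_iff ..).2 ⟨ha, hs⟩, a, (sub_add_cancel _ _).symm⟩
  rw [hleft, hright]
  refine ⟨Set.toFinite _, Set.toFinite _, ?_⟩
  rw [Set.ncard_image_of_injective _ haddInj, Set.ncard_image_of_injective _ hsubInj]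
  by_cases hs : ∑ i, (h i - f i) = (k : ℤ) + 1
  · have := card_gapRows_add_eq_card_gapRows_sub hf hh
    simpa [hs, Set.ncard_eq_toFinset_card'] using this
  · simp only [hs, and_false]

end

theorem permissible_iff_cyclicallyDecreasing (n ℓ : ℕ) (g : Fin (n + 1) → ℤ) :
    ((∀ i j : Fin (n + 1), i ≤ j → g j ≤ g i) ∧ g 0 - g (Fin.last n) ≤ (ℓ : ℤ)) ↔
      CyclicallyDecreasing (finRotate (n + 1)) (fun i => if i = Fin.last n then (ℓ : ℤ) else 0)
        g := by
  have hanti : (∀ i j : Fin (n + 1), i ≤ j → g j ≤ g i) ↔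
      ∀ i : Fin n, g i.succ ≤ g i.castSucc := by
    rw [← Fin.antitone_iff_succ_le]
    rfl
  rw [hanti, sub_le_iff_le_add']
  simp [CyclicallyDecreasing, Fin.forall_fin_succ', Fin.castSucc_ne_last]

/-- For permissible signatures `f`, `h`: the number of permissible `g` with
`f ≺ g ≺_k h` equals the number of permissible `g` with `f ≺_k g ≺ h`. -/
theorem permissible_path_count (N ℓ k : ℕ) (hN : 1 ≤ N) (hk1 : 1 ≤ k) (hkN : k ≤ N)
    (f h : Fin N → ℤ)
    (hfsig : ∀ i j : Fin N, i ≤ j → f j ≤ f i)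
    (hfperm : f ⟨0, by omega⟩ - f ⟨N - 1, by omega⟩ ≤ (ℓ : ℤ))
    (hhsig : ∀ i j : Fin N, i ≤ j → h j ≤ h i)
    (hhperm : h ⟨0, by omega⟩ - h ⟨N - 1, by omega⟩ ≤ (ℓ : ℤ)) :
    let Adds : ℕ → (Fin N → ℤ) → (Fin N → ℤ) → Prop := fun r u w =>
      (∀ i, w i = u i ∨ w i = u i + 1) ∧ (∑ i, (w i - u i)) = (r : ℤ)
    let Permissible : (Fin N → ℤ) → Prop := fun g =>
      (∀ i j : Fin N, i ≤ j → g j ≤ g i) ∧ g ⟨0, by omega⟩ - g ⟨N - 1, by omega⟩ ≤ (ℓ : ℤ)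
    let S₁ : Set (Fin N → ℤ) := {g | Permissible g ∧ Adds 1 f g ∧ Adds k g h}
    let S₂ : Set (Fin N → ℤ) := {g | Permissible g ∧ Adds k f g ∧ Adds 1 g h}
    S₁.Finite ∧ S₂.Finite ∧ S₁.ncard = S₂.ncard := by
  obtain ⟨n, rfl⟩ : ∃ n, N = n + 1 := ⟨N - 1, by omega⟩
  intro Adds Permissible S₁ S₂
  have hperm : ∀ g, Permissible g ↔ CyclicallyDecreasing (finRotate (n + 1))
      (fun i => if i = Fin.last n then (ℓ : ℤ) else 0) g :=
    permissible_iff_cyclicallyDecreasing n ℓ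
  have hresult := finite_and_ncard_eq_of_cyclicallyDecreasing k
    ((hperm f).1 ⟨hfsig, hfperm⟩) ((hperm h).1 ⟨hhsig, hhperm⟩)
  simp only [← hperm] at hresult
  exact hresult
end

section
/- Fix integers N ≥ 1 and ℓ ≥ 0 and set c = N + ℓ. Let h be a signature of length N permissible at level ℓ with h_N = 0, set H = (Σ_{k=1}^N (h_k + N − k))/N, and define t ∈ ℂ^N by t_j = exp(2πi·(h_j + N − j − H)/c) for 1 ≤ j ≤ N. Then for every a ∈ ℤ^N, every σ ∈ S_N, and every m ∈ ℤ^N with Σᵢ mᵢ = 0: det((t_j)^{a_{σ(i)} + c·m_i})_{i,j=1}^{N} = sgn(σ) · det((t_j)^{a_i})_{i,j=1}^{N}. (Hence the restricted alternants satisfy X_{σ(f+δ)−δ}|_𝒯 = det(σ)·X_f|_𝒯 and X_{f+m}|_𝒯 = X_f|_𝒯 for m ∈ Λ₀.) -/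
/-- If all `t j ≠ 0` share the same `c`-th power, then the alternant `det (t j ^ a i)` is
alternating in the exponents and invariant under shifting them by `c • m` with `∑ i, m i = 0`. -/
theorem det_zpow_perm_add_mul {n K : Type*} [Fintype n] [DecidableEq n] [Field K]
    {t : n → K} (ht : ∀ j, t j ≠ 0) {c : ℤ} {w : K} (hw : w ≠ 0) (htc : ∀ j, t j ^ c = w)
    (a : n → ℤ) (σ : Equiv.Perm n) {m : n → ℤ} (hm : ∑ i, m i = 0) :
    Matrix.det (Matrix.of fun i j => t j ^ (a (σ i) + c * m i)) =
      ((Equiv.Perm.sign σ : ℤ) : K) * Matrix.det (Matrix.of fun i j => t j ^ a i) := by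
  have hprod : ∀ s : Finset n, ∏ i ∈ s, w ^ m i = w ^ ∑ i ∈ s, m i := by
    intro s
    induction s using Finset.induction_on with
    | empty => simp
    | insert i s hi ih => rw [Finset.prod_insert hi, Finset.sum_insert hi, ih, zpow_add₀ hw]
  have hentry : (Matrix.of fun i j => t j ^ (a (σ i) + c * m i)) =
      Matrix.of fun i j =>
        w ^ m i * (Matrix.of fun i j => t j ^ a i).submatrix σ id i j := by
    ext i j
    simp [zpow_add₀ (ht j), zpow_mul, htc, mul_comm]
  rw [hentry, Matrix.det_mul_column, hprod, hm, zpow_zero, one_mul, Matrix.det_permute]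

/-- Symmetry of the restricted alternants: for `t_j = exp(2πi(h_j + N − j − H)/(N+ℓ))`,
`det(t_j^{a_{σ(i)} + (N+ℓ)m_i}) = sgn(σ)·det(t_j^{a_i})` whenever `Σ m_i = 0`. -/
theorem alternant_symmetry (N ℓ : ℕ) (hN : 1 ≤ N)
    (h : Fin N → ℤ)
    (hsig : ∀ i j : Fin N, i ≤ j → h j ≤ h i)
    (hlast : h ⟨N - 1, by omega⟩ = 0)
    (hperm : h ⟨0, by omega⟩ - h ⟨N - 1, by omega⟩ ≤ (ℓ : ℤ)) :
    let c : ℂ := (N : ℂ) + (ℓ : ℂ)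
    let Hc : ℂ := (∑ kk : Fin N, ((h kk : ℂ) + (N : ℂ) - 1 - ((kk : ℕ) : ℂ))) / (N : ℂ)
    let t : Fin N → ℂ := fun j =>
      Complex.exp (2 * (Real.pi : ℂ) * Complex.I *
        (((h j : ℂ) + (N : ℂ) - 1 - ((j : ℕ) : ℂ) - Hc) / c))
    ∀ (a : Fin N → ℤ) (σ : Equiv.Perm (Fin N)) (m : Fin N → ℤ), (∑ i, m i) = 0 →
      Matrix.det (Matrix.of fun i j : Fin N =>
          t j ^ (a (σ i) + ((N : ℤ) + (ℓ : ℤ)) * m i)) =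
        ((Equiv.Perm.sign σ : ℤ) : ℂ) *
          Matrix.det (Matrix.of fun i j : Fin N => t j ^ (a i)) := by
  intro c Hc t a σ m hm
  have hc : c ≠ 0 := by
    have : ((N + ℓ : ℕ) : ℂ) ≠ 0 := Nat.cast_ne_zero.mpr (by omega)
    simpa [c] using this
  refine det_zpow_perm_add_mul (w := Complex.exp (-(2 * Real.pi * Complex.I * Hc)))
    (fun j => Complex.exp_ne_zero _) (Complex.exp_ne_zero _) (fun j => ?_) a σ hm
  have hcast : (((N : ℤ) + (ℓ : ℤ) : ℤ) : ℂ) = c := by simp [c]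
  rw [← Complex.exp_int_mul, hcast, Complex.exp_eq_exp_iff_exists_int]
  refine ⟨h j + N - 1 - (j : ℕ), ?_⟩
  push_cast
  field_simp
  ring
end
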